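/- arXiv:1503.08790 — 2 statements merged into one kernel-verified Lean document; each statement's English description precedes it below -/
import Mathlib

section
/- Fix an integer j ≥ 1 and K > 0. For a positive integer N set m = N/2 and υ_{h,k} = (h+2)(2k+1)/2. Then, as N → ∞, Σ_{h,k ≥ 0, h ≡ N (mod 2)} ((2υ_{h,k}² − m)/m) · υ_{h,k}^{2j} · exp(−υ_{h,k}²/m) = ((log m)/2 + 2γ + log 2 + ψ(j+1/2)/2 + 1/(2j) + [N odd]·(2 log 2 − 2)) · (j/2) Γ(j+1/2) m^{j+1/2} + O(m^{−K}), where γ is the Euler–Mascheroni constant and ψ(j+1/2) = −γ − 2 log 2 + 2 Σ_{i=1}^{j} 1/(2i−1) is the digamma function at the half-integer j+1/2 (so the bracket equals (log m)/2 + 3γ/2 + Σ_{i=1}^{j} 1/(2i−1) + 1/(2j) + [N odd]·(2 log 2 − 2)). [N odd] denotes the Iverson bracket, equal to 1 if N is odd (m ∉ ℕ) and 0 otherwise. -/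
open Real

/-- `υ_{h,k} = (h+2)(2k+1)/2`. -/
noncomputable def upsHK (h k : ℕ) : ℝ := ((h : ℝ) + 2) * (2 * (k : ℝ) + 1) / 2

/-- Summand of the harmonic sum (4.2) with weight `υ_{h,k}^{2j}`: for pairs `(h,k)` with
`h ≡ N (mod 2)`, `((2υ_{h,k}² − m)/m) υ_{h,k}^{2j} exp(−υ_{h,k}²/m)` with `m = N/2`. -/
noncomputable def upsSummandJ (j N : ℕ) (p : ℕ × ℕ) : ℝ :=
  if p.1 % 2 = N % 2 then
    (2 * upsHK p.1 p.2 ^ 2 - (N : ℝ) / 2) / ((N : ℝ) / 2) * upsHK p.1 p.2 ^ (2 * j) *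
      Real.exp (-(upsHK p.1 p.2 ^ 2 / ((N : ℝ) / 2)))
  else 0

/-- The value `ψ(j+1/2) = −γ − 2 log 2 + 2 Σ_{i=1}^{j} 1/(2i−1)` of the digamma function at the
half-integer `j + 1/2`. -/
noncomputable def digammaHalf (j : ℕ) : ℝ :=
  -Real.eulerMascheroniConstant - 2 * Real.log 2 +
    2 * ∑ i ∈ Finset.range j, (1 : ℝ) / (2 * (i : ℝ) + 1)

open Polynomial in
noncomputable def gP (P : ℝ[X]) (x : ℝ) : ℝ := P.eval x * Real.exp (-x ^ 2)

open Polynomial in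
lemma gP_bdd (P : ℝ[X]) : ∃ C : ℝ, 0 ≤ C ∧ ∀ x, |gP P x| ≤ C := by
  induction P using Polynomial.induction_on' with
  | add p q hp hq =>
    obtain ⟨A, hA, hA'⟩ := hp
    obtain ⟨B, hB, hB'⟩ := hq
    refine ⟨A + B, by positivity, fun x => ?_⟩
    have : gP (p + q) x = gP p x + gP q x := by simp [gP, add_mul]
    rw [this]
    exact (abs_add_le _ _).trans (add_le_add (hA' x) (hB' x))
  | monomial n a =>
    refine ⟨|a| * (n.factorial * Real.exp 1), by positivity, fun x => ?_⟩
    simp only [gP, Polynomial.eval_monomial]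
    rw [abs_mul, abs_mul, abs_pow, Real.abs_exp, mul_assoc]
    refine mul_le_mul_of_nonneg_left ?_ (abs_nonneg a)
    have h1 : |x| ^ n / n.factorial ≤ Real.exp |x| := Real.pow_div_factorial_le_exp _ (abs_nonneg x) n
    rw [div_le_iff₀ (by positivity)] at h1
    calc |x| ^ n * Real.exp (-x ^ 2) ≤ (Real.exp |x| * n.factorial) * Real.exp (-x ^ 2) := by gcongr
      _ = n.factorial * Real.exp (|x| - x ^ 2) := by rw [sub_eq_add_neg, Real.exp_add]; ring
      _ ≤ _ := by
        gcongr
        nlinarith [sq_abs x, sq_nonneg (|x| - 1)]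

open Polynomial in
lemma gP_bdd_pow (P : ℝ[X]) (n : ℕ) : ∃ C : ℝ, 0 ≤ C ∧ ∀ x, |x| ^ n * |gP P x| ≤ C := by
  obtain ⟨C, hC, h⟩ := gP_bdd (X ^ n * P)
  refine ⟨C, hC, fun x => ?_⟩
  have := h x
  simpa [gP, abs_mul, mul_assoc] using this

open Polynomial in
lemma gP_bdd_sq (P : ℝ[X]) : ∃ C : ℝ, 0 ≤ C ∧ ∀ x, |gP P x| ≤ C / (1 + x ^ 2) := by
  obtain ⟨C, hC, h⟩ := gP_bdd ((1 + X ^ 2) * P)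
  refine ⟨C, hC, fun x => ?_⟩
  have := h x
  rw [le_div_iff₀ (by positivity)]
  have h2 : |1 + x ^ 2| = 1 + x ^ 2 := abs_of_nonneg (by positivity)
  simp only [gP, abs_mul, eval_mul, eval_add, eval_one, eval_pow, eval_X, h2] at this ⊢
  linarith

open Polynomial in
noncomputable def dP (P : ℝ[X]) : ℝ[X] := derivative P - 2 * X * P

open Polynomial in
lemma gP_deriv (P : ℝ[X]) (x : ℝ) : HasDerivAt (gP P) (gP (dP P) x) x := by
  have h1 := P.hasDerivAt x
  have h2 : HasDerivAt (fun x : ℝ => Real.exp (-x ^ 2)) (Real.exp (-x ^ 2) * (-(2 * x))) x := by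
    have := ((hasDerivAt_pow 2 x).neg).exp
    simpa using this
  refine (h1.fun_mul h2).congr_deriv ?_
  simp only [gP, dP, Polynomial.eval_sub, Polynomial.eval_mul, Polynomial.eval_X,
    Polynomial.eval_ofNat]
  ring

lemma summable_int_sq : Summable (fun b : ℤ => 1 / (1 + (b : ℝ) ^ 2)) := by
  have h := (Real.summable_one_div_int_pow (p := 2)).2 (by norm_num)
  refine Summable.of_norm_bounded_eventually (g := fun b : ℤ => 1 / (b : ℝ) ^ 2) h ?_
  have : ∀ᶠ b : ℤ in Filter.cofinite, b ≠ 0 := by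
    rw [Filter.eventually_cofinite]; simp
  filter_upwards [this] with b hb
  rw [Real.norm_of_nonneg (by positivity)]
  have : (b : ℝ) ≠ 0 := by exact_mod_cast hb
  gcongr
  linarith

lemma bound_eps {C ε : ℝ} (hC : 0 ≤ C) (h0 : 0 < ε) (h1 : ε ≤ 1) (b : ℝ) :
    C / (1 + (b * ε) ^ 2) ≤ C / ε ^ 2 * (1 / (1 + b ^ 2)) := by
  rw [div_mul_div_comm, mul_one]
  gcongr
  nlinarith [sq_nonneg b, pow_le_one₀ h0.le h1 (n := 2)]

lemma summable_alt {g : ℝ → ℝ} {C ε : ℝ} (hC : 0 ≤ C) (hg : ∀ x, |g x| ≤ C / (1 + x ^ 2))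
    (h0 : 0 < ε) (h1 : ε ≤ 1) : Summable (fun b : ℤ => (-1 : ℝ) ^ b * g (b * ε)) := by
  refine Summable.of_norm_bounded (g := fun b : ℤ => C / ε ^ 2 * (1 / (1 + (b : ℝ) ^ 2)))
    (summable_int_sq.mul_left _) fun b => ?_
  rw [norm_mul, norm_zpow, norm_neg, norm_one, one_zpow, one_mul]
  exact (hg _).trans (bound_eps hC h0 h1 b)

lemma alt_bound (K : ℕ) : ∀ (G : ℕ → ℝ → ℝ) (C : ℝ), 0 ≤ C →
    (∀ i < K, ∀ x, HasDerivAt (G i) (G (i + 1) x) x) →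
    (∀ i ≤ K, ∀ x, |G i x| ≤ C / (1 + x ^ 2)) → ∀ ε : ℝ, 0 < ε → ε ≤ 1 →
    |∑' b : ℤ, (-1 : ℝ) ^ b * G 0 (b * ε)| ≤
      C * (3 * ε / 2) ^ K * ((∑' b : ℤ, 1 / (1 + (b : ℝ) ^ 2)) / ε ^ 2) := by
  induction K with
  | zero =>
    intro G C hC _ hb ε h0 h1
    have hb0 := hb 0 le_rfl
    have := tsum_of_norm_bounded (f := fun b : ℤ => (-1 : ℝ) ^ b * G 0 (b * ε))
      (g := fun b : ℤ => C / ε ^ 2 * (1 / (1 + (b : ℝ) ^ 2)))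
      ((summable_int_sq.mul_left _).hasSum) (fun b => by
        rw [norm_mul, norm_zpow, norm_neg, norm_one, one_zpow, one_mul]
        exact (hb0 _).trans (bound_eps hC h0 h1 b))
    rw [tsum_mul_left, Real.norm_eq_abs] at this
    calc _ ≤ _ := this
      _ = _ := by ring
  | succ K ih =>
    intro G C hC hd hb ε h0 h1
    set G' : ℕ → ℝ → ℝ := fun i y => (G i y - G i (y + ε)) / ε with hG'
    have hs := summable_alt hC (hb 0 (by omega)) h0 h1
    have key := ih G' (3 * C) (by positivity) (fun i hi x => by
      have a1 := hd i (by omega) x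
      have a2 := (hd i (by omega) (x + ε)).comp_add_const x ε
      exact (a1.sub a2).div_const ε) (fun i hi x => by
      obtain ⟨c, hc, hc'⟩ := exists_hasDerivAt_eq_slope (G i) (G (i + 1)) (show x < x + ε by linarith)
        (fun y _ => (hd i (by omega) y).continuousAt.continuousWithinAt)
        (fun y _ => hd i (by omega) y)
      have : G' i x = - G (i + 1) c := by
        rw [hc', hG']; simp only [add_sub_cancel_left]; ring
      rw [this, abs_neg]
      refine (hb (i + 1) (by omega) c).trans ?_
      rw [div_le_div_iff₀ (by positivity) (by positivity)]
      have : 1 + x ^ 2 ≤ 3 * (1 + c ^ 2) := by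
        have := hc.1
        have := hc.2
        nlinarith [sq_nonneg (c + (c - x)), sq_nonneg (c - x), sq_nonneg (2 * c - x)]
      nlinarith) ε h0 h1
    have e1 : ∑' b : ℤ, (-1 : ℝ) ^ b * G 0 (b * ε) = ε / 2 * ∑' b : ℤ, (-1 : ℝ) ^ b * G' 0 (b * ε) := by
      have sh : ∑' b : ℤ, (-1 : ℝ) ^ b * G 0 (b * ε) =
          ∑' b : ℤ, -((-1 : ℝ) ^ b * G 0 (b * ε + ε)) := by
        rw [← (Equiv.addRight (1 : ℤ)).tsum_eq]
        refine tsum_congr fun b => ?_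
        simp only [Equiv.coe_addRight, zpow_add₀ (show (-1 : ℝ) ≠ 0 by norm_num)]
        push_cast
        rw [add_mul]; ring_nf
      have hs2 : Summable (fun b : ℤ => -((-1 : ℝ) ^ b * G 0 (b * ε + ε))) := by
        rw [← (Equiv.addRight (1 : ℤ)).summable_iff] at hs
        refine hs.congr fun b => ?_
        simp only [Function.comp, Equiv.coe_addRight, zpow_add₀ (show (-1 : ℝ) ≠ 0 by norm_num)]
        push_cast
        rw [add_mul]; ring_nf
      have : ∑' b : ℤ, (-1 : ℝ) ^ b * G' 0 (b * ε) = (1 / ε) * (∑' b : ℤ, (-1 : ℝ) ^ b * G 0 (b * ε)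
          + ∑' b : ℤ, -((-1 : ℝ) ^ b * G 0 (b * ε + ε))) := by
        rw [← hs.tsum_add hs2, ← tsum_mul_left]
        refine tsum_congr fun b => ?_
        simp only [hG']; ring
      rw [this, ← sh]
      generalize (∑' b : ℤ, (-1 : ℝ) ^ b * G 0 (b * ε)) = S
      field_simp; ring
    rw [e1, abs_mul, abs_of_pos (by positivity : 0 < ε / 2)]
    calc _ ≤ ε / 2 * _ := mul_le_mul_of_nonneg_left key (by positivity)
      _ = _ := by ring

lemma alt_bound' (G : ℕ → ℝ → ℝ) (hd : ∀ i, ∀ x, HasDerivAt (G i) (G (i + 1) x) x)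
    (hb : ∀ i, ∃ C, 0 ≤ C ∧ ∀ x, |G i x| ≤ C / (1 + x ^ 2)) (K : ℕ) :
    ∃ C, 0 ≤ C ∧ ∀ ε : ℝ, 0 < ε → ε ≤ 1 →
      |∑' b : ℤ, (-1 : ℝ) ^ b * G 0 (b * ε)| ≤ C * ε ^ K := by
  choose C hC hC' using hb
  set C0 := ∑ i ∈ Finset.range (K + 3), C i
  have hC0 : 0 ≤ C0 := Finset.sum_nonneg fun i _ => hC i
  have hM : 0 ≤ ∑' b : ℤ, 1 / (1 + (b : ℝ) ^ 2) := tsum_nonneg fun b => by positivity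
  refine ⟨C0 * (3 / 2) ^ (K + 2) * (∑' b : ℤ, 1 / (1 + (b : ℝ) ^ 2)), by positivity,
    fun ε h0 h1 => ?_⟩
  refine (alt_bound (K + 2) G C0 hC0 (fun i _ => hd i) (fun i hi x => (hC' i x).trans ?_) ε h0 h1).trans
    (le_of_eq ?_)
  · gcongr
    exact Finset.single_le_sum (f := C) (fun i _ => hC i) (Finset.mem_range.2 (by omega))
  · rw [show 3 * ε / 2 = (3 / 2) * ε by ring, mul_pow, pow_add ε]
    field_simp


noncomputable def psi (P : Polynomial ℝ) (i : ℕ) (x : ℝ) : ℝ :=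
  if x = 0 then 0 else ∑' a : ℤ, (-1 : ℝ) ^ a * ((a : ℝ) ^ i * gP (dP^[i] P) (a * x))

lemma gP_alt (Q : Polynomial ℝ) (K : ℕ) : ∃ C, 0 ≤ C ∧ ∀ ε : ℝ, 0 < ε → ε ≤ 1 →
    |∑' b : ℤ, (-1 : ℝ) ^ b * gP Q (b * ε)| ≤ C * ε ^ K := by
  refine alt_bound' (fun i => gP (dP^[i] Q)) (fun i x => ?_) (fun i => gP_bdd_sq _) K
  simp only [Function.iterate_succ_apply']
  exact gP_deriv _ x

lemma psi_neg (P : Polynomial ℝ) (i : ℕ) (x : ℝ) : psi P i (-x) = (-1) ^ i * psi P i x := by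
  unfold psi
  by_cases h : x = 0
  · simp [h]
  · rw [if_neg h, if_neg (neg_ne_zero.2 h), ← (Equiv.neg ℤ).tsum_eq, ← tsum_mul_left]
    refine tsum_congr fun a => ?_
    simp only [Equiv.neg_apply, zpow_neg, Int.cast_neg, neg_mul_neg]
    rw [← inv_zpow, neg_pow (a : ℝ) i, show ((-1 : ℝ)⁻¹) = -1 by norm_num]
    ring

lemma psi_small (P : Polynomial ℝ) (i : ℕ) :
    ∃ C, 0 ≤ C ∧ ∀ x : ℝ, |x| ≤ 1 → |psi P i x| ≤ C * x ^ 2 := by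
  obtain ⟨C, hC, h⟩ := gP_alt (Polynomial.X ^ i * dP^[i] P) (i + 2)
  refine ⟨C, hC, ?_⟩
  have pos : ∀ x : ℝ, 0 < x → x ≤ 1 → |psi P i x| ≤ C * x ^ 2 := by
    intro x h0 h1
    have e : ∑' b : ℤ, (-1 : ℝ) ^ b * gP (Polynomial.X ^ i * dP^[i] P) (b * x) =
        x ^ i * psi P i x := by
      rw [psi, if_neg h0.ne', ← tsum_mul_left]
      refine tsum_congr fun a => ?_
      simp only [gP, Polynomial.eval_mul, Polynomial.eval_pow, Polynomial.eval_X]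
      ring
    have := h x h0 h1
    rw [e, abs_mul, abs_of_pos (pow_pos h0 i), pow_add] at this
    have hp := pow_pos h0 i
    refine le_of_mul_le_mul_left ?_ hp
    linarith
  intro x hx
  rcases lt_trichotomy x 0 with hx0 | rfl | hx0
  · have := pos (-x) (by linarith) (by rwa [abs_of_neg hx0] at hx)
    rw [psi_neg, abs_mul, abs_pow, abs_neg, abs_one, one_pow, one_mul, neg_sq] at this
    exact this
  · simp [psi]
  · exact pos x hx0 (by rwa [abs_of_pos hx0] at hx)

lemma psi_term (P : Polynomial ℝ) (hP : P.eval 0 = 0) (i : ℕ) :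
    ∃ C, 0 ≤ C ∧ ∀ x : ℝ, x ≠ 0 → ∀ a : ℤ,
      ‖(-1 : ℝ) ^ a * ((a : ℝ) ^ i * gP (dP^[i] P) (a * x))‖ ≤
        C / |x| ^ (i + 2) * (1 / (a : ℝ) ^ 2) := by
  obtain ⟨C, hC, h⟩ := gP_bdd_pow (dP^[i] P) (i + 2)
  refine ⟨C, hC, fun x hx a => ?_⟩
  have hx' : 0 < |x| := abs_pos.2 hx
  rw [norm_mul, norm_zpow, norm_neg, norm_one, one_zpow, one_mul]
  by_cases ha : a = 0
  · subst ha
    cases i with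
    | zero => simp [gP, hP]
    | succ i => simp
  · have ha' : 0 < |(a : ℝ)| := abs_pos.2 (by exact_mod_cast ha)
    have := h (a * x)
    rw [norm_mul, norm_pow, Real.norm_eq_abs, Real.norm_eq_abs, div_mul_div_comm, mul_one,
      le_div_iff₀ (by rw [← sq_abs]; positivity)]
    rw [abs_mul, mul_pow, pow_add |(a : ℝ)|, sq_abs] at this
    linarith

lemma summ_inv_sq : Summable (fun a : ℤ => 1 / (a : ℝ) ^ 2) :=
  (Real.summable_one_div_int_pow (p := 2)).2 (by norm_num)

lemma psi_large (P : Polynomial ℝ) (hP : P.eval 0 = 0) (i : ℕ) :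
    ∃ C, 0 ≤ C ∧ ∀ x : ℝ, 1 ≤ |x| → |psi P i x| ≤ C / x ^ 2 := by
  obtain ⟨C, hC, h⟩ := psi_term P hP i
  have hM : 0 ≤ ∑' a : ℤ, 1 / (a : ℝ) ^ 2 := tsum_nonneg fun b => by positivity
  refine ⟨C * ∑' a : ℤ, 1 / (a : ℝ) ^ 2, by positivity, fun x hx => ?_⟩
  have hx0 : x ≠ 0 := by rintro rfl; norm_num at hx
  have := tsum_of_norm_bounded ((summ_inv_sq.mul_left (C / |x| ^ (i + 2))).hasSum) (h x hx0)
  rw [psi, if_neg hx0]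
  rw [tsum_mul_left, Real.norm_eq_abs] at this
  refine this.trans ?_
  rw [mul_div_right_comm]
  refine mul_le_mul_of_nonneg_right ?_ hM
  rw [pow_add, sq_abs]
  have : 0 < x ^ 2 := by positivity
  gcongr
  exact le_mul_of_one_le_left this.le (one_le_pow₀ hx)

lemma psi_bound (P : Polynomial ℝ) (hP : P.eval 0 = 0) (i : ℕ) :
    ∃ C, 0 ≤ C ∧ ∀ x : ℝ, |psi P i x| ≤ C / (1 + x ^ 2) := by
  obtain ⟨C, hC, h⟩ := psi_small P i
  obtain ⟨D, hD, h'⟩ := psi_large P hP i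
  refine ⟨2 * C + 2 * D, by positivity, fun x => ?_⟩
  rw [le_div_iff₀ (by positivity)]
  rcases le_total |x| 1 with hx | hx
  · have h1 := h x hx
    have : x ^ 2 ≤ 1 := by rw [← sq_abs]; exact pow_le_one₀ (abs_nonneg x) hx
    nlinarith [abs_nonneg (psi P i x), sq_nonneg x, mul_le_mul_of_nonneg_left this hC]
  · have h1 := h' x hx
    have : 1 ≤ x ^ 2 := by rw [← sq_abs]; exact one_le_pow₀ hx
    rw [le_div_iff₀ (by linarith)] at h1
    nlinarith [abs_nonneg (psi P i x)]

lemma psi_deriv (P : Polynomial ℝ) (hP : P.eval 0 = 0) (i : ℕ) (x : ℝ) :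
    HasDerivAt (psi P i) (psi P (i + 1) x) x := by
  by_cases hx : x = 0
  · subst hx
    obtain ⟨C, hC, h⟩ := psi_small P i
    have e0 : ∀ k, psi P k 0 = 0 := fun k => by simp [psi]
    rw [e0, hasDerivAt_iff_isLittleO]
    simp only [e0, sub_zero, smul_zero]
    have h1 : psi P i =O[nhds 0] fun x : ℝ => x ^ 2 := by
      refine Asymptotics.IsBigO.of_bound C ?_
      filter_upwards [Metric.ball_mem_nhds (0 : ℝ) one_pos] with y hy
      rw [Metric.mem_ball, dist_zero_right, Real.norm_eq_abs] at hy
      rw [Real.norm_eq_abs, Real.norm_of_nonneg (sq_nonneg y)]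
      exact h y hy.le
    refine h1.trans_isLittleO ?_
    simpa using Asymptotics.isLittleO_pow_pow (𝕜 := ℝ) (show 1 < 2 by norm_num)
  · obtain ⟨C, hC, h⟩ := psi_term P hP i
    obtain ⟨D, hD, h'⟩ := psi_term P hP (i + 1)
    have hx' : 0 < |x| := abs_pos.2 hx
    have hball : ∀ y ∈ Metric.ball x (|x| / 2), |x| / 2 ≤ |y| := by
      intro y hy
      rw [Metric.mem_ball, Real.dist_eq] at hy
      have := abs_sub_abs_le_abs_sub x y
      rw [abs_sub_comm] at this
      linarith
    have hne : ∀ y ∈ Metric.ball x (|x| / 2), y ≠ 0 := by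
      intro y hy h0
      have := hball y hy
      rw [h0, abs_zero] at this
      linarith
    have hxb : x ∈ Metric.ball x (|x| / 2) := Metric.mem_ball_self (by positivity)
    have key := hasDerivAt_tsum_of_isPreconnected
      (g := fun (a : ℤ) y => (-1 : ℝ) ^ a * ((a : ℝ) ^ i * gP (dP^[i] P) (a * y)))
      (g' := fun (a : ℤ) y => (-1 : ℝ) ^ a * ((a : ℝ) ^ (i + 1) * gP (dP^[i + 1] P) (a * y)))
      (t := Metric.ball x (|x| / 2)) (y₀ := x) (y := x)
      (summ_inv_sq.mul_left (D / (|x| / 2) ^ (i + 1 + 2))) Metric.isOpen_ball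
      (convex_ball x _).isPreconnected
      (fun a y _ => by
        have h1 := (gP_deriv (dP^[i] P) (a * y)).comp y ((hasDerivAt_id y).const_mul (a : ℝ))
        have h2 := (h1.const_mul ((a : ℝ) ^ i)).const_mul ((-1 : ℝ) ^ a)
        refine h2.congr_deriv ?_
        rw [Function.iterate_succ_apply', pow_succ]
        ring)
      (fun a y hy => (h' y (hne y hy) a).trans (by
        have := hball y hy
        gcongr)) hxb
      (Summable.of_norm_bounded (summ_inv_sq.mul_left (C / |x| ^ (i + 2))) (h x hx)) hxb
    rw [psi, if_neg hx]
    refine key.congr_of_eventuallyEq ?_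
    filter_upwards [Metric.isOpen_ball.mem_nhds hxb] with y hy
    rw [psi, if_neg (hne y hy)]

lemma psi_alt (P : Polynomial ℝ) (hP : P.eval 0 = 0) (K : ℕ) :
    ∃ C, 0 ≤ C ∧ ∀ ε : ℝ, 0 < ε → ε ≤ 1 →
    |∑' b : ℤ, (-1 : ℝ) ^ b * psi P 0 (b * ε)| ≤ C * ε ^ K :=
  alt_bound' (psi P) (fun i x => psi_deriv P hP i x) (fun i => psi_bound P hP i) K


noncomputable def sumS (f : ℝ → ℝ) (x : ℝ) : ℝ := ∑' n : ℕ, f (((n : ℝ) + 1) * x)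

lemma summable_nat_sq : Summable (fun n : ℕ => 1 / ((n : ℝ) + 1) ^ 2) := by
  have h := (Real.summable_one_div_nat_pow (p := 2)).2 (by norm_num)
  have := (summable_nat_add_iff 1).2 h
  simpa using this

lemma sumS_term {f : ℝ → ℝ} {C : ℝ} (hf : ∀ x, 0 < x → |f x| ≤ C / x ^ 2) {x : ℝ} (hx : 0 < x)
    (n : ℕ) : ‖f (((n : ℝ) + 1) * x)‖ ≤ C / x ^ 2 * (1 / ((n : ℝ) + 1) ^ 2) := by
  refine (hf _ (by positivity)).trans (le_of_eq ?_)
  field_simp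

lemma sumS_summable {f : ℝ → ℝ} {C : ℝ} (hf : ∀ x, 0 < x → |f x| ≤ C / x ^ 2) {x : ℝ} (hx : 0 < x) :
    Summable (fun n : ℕ => f (((n : ℝ) + 1) * x)) :=
  Summable.of_norm_bounded (summable_nat_sq.mul_left _) (sumS_term hf hx)

lemma sumS_bound {f : ℝ → ℝ} {C : ℝ} (hf : ∀ x, 0 < x → |f x| ≤ C / x ^ 2) :
    ∀ x, 0 < x → |sumS f x| ≤ (C * ∑' n : ℕ, 1 / ((n : ℝ) + 1) ^ 2) / x ^ 2 := by
  intro x hx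
  have := tsum_of_norm_bounded ((summable_nat_sq.mul_left (C / x ^ 2)).hasSum) (sumS_term hf hx)
  rw [tsum_mul_left, ← mul_div_right_comm] at this
  exact this

lemma odd_summable {f : ℝ → ℝ} {C : ℝ} (hf : ∀ x, 0 < x → |f x| ≤ C / x ^ 2) {x : ℝ} (hx : 0 < x) :
    Summable (fun k : ℕ => f ((2 * (k : ℝ) + 1) * x)) := by
  have h := (sumS_summable hf hx).comp_injective (i := fun k : ℕ => 2 * k) (fun a b h => by simpa using h)
  refine h.congr fun k => ?_
  simp

lemma odd_split {f : ℝ → ℝ} {C : ℝ} (hf : ∀ x, 0 < x → |f x| ≤ C / x ^ 2) {x : ℝ} (hx : 0 < x) :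
    ∑' k : ℕ, f ((2 * (k : ℝ) + 1) * x) = sumS f x - sumS f (2 * x) := by
  have h1 := odd_summable hf hx
  have h2 := sumS_summable hf (show 0 < 2 * x by positivity)
  have e2 : ∀ k : ℕ, f ((((2 * k + 1 : ℕ) : ℝ) + 1) * x) = f (((k : ℝ) + 1) * (2 * x)) := by
    intro k; congr 1; push_cast; ring
  have e1 : ∀ k : ℕ, f ((((2 * k : ℕ) : ℝ) + 1) * x) = f ((2 * (k : ℝ) + 1) * x) := by
    intro k; congr 1; push_cast; ring
  have := tsum_even_add_odd (f := fun n : ℕ => f (((n : ℝ) + 1) * x))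
    (by simpa only [e1] using h1) (by simpa only [e2] using h2)
  simp only [e1, e2] at this
  rw [sumS, sumS]
  linarith

lemma alt_nat {f : ℝ → ℝ} {C : ℝ} (hf : ∀ x, 0 < x → |f x| ≤ C / x ^ 2) {x : ℝ} (hx : 0 < x) :
    HasSum (fun n : ℕ => (-1 : ℝ) ^ (n + 1) * f (((n : ℝ) + 1) * x))
      (-(sumS f x - 2 * sumS f (2 * x))) := by
  have h1 := (odd_summable hf hx).hasSum
  have h2 := (sumS_summable hf (show 0 < 2 * x by positivity)).hasSum
  rw [odd_split hf hx] at h1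
  have e2 : ∀ k : ℕ, (-1 : ℝ) ^ (2 * k + 1 + 1) * f ((((2 * k + 1 : ℕ) : ℝ) + 1) * x)
      = f (((k : ℝ) + 1) * (2 * x)) := by
    intro k
    rw [show (-1 : ℝ) ^ (2 * k + 1 + 1) = 1 from Even.neg_one_pow ⟨k + 1, by ring⟩, one_mul]
    congr 1; push_cast; ring
  have e1 : ∀ k : ℕ, (-1 : ℝ) ^ (2 * k + 1) * f ((((2 * k : ℕ) : ℝ) + 1) * x)
      = -f ((2 * (k : ℝ) + 1) * x) := by
    intro k
    rw [show (-1 : ℝ) ^ (2 * k + 1) = -1 from Odd.neg_one_pow ⟨k, by ring⟩, neg_one_mul]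
    congr 2; push_cast; ring
  have := HasSum.even_add_odd (f := fun n : ℕ => (-1 : ℝ) ^ (n + 1) * f (((n : ℝ) + 1) * x))
    (by simpa only [e1] using h1.neg) (by simpa only [e2] using h2)
  convert this using 1
  rw [sumS, sumS]; ring

lemma alt_split {f : ℝ → ℝ} {C : ℝ} (hf : ∀ x, 0 < x → |f x| ≤ C / x ^ 2) (h0 : f 0 = 0)
    (he : ∀ x, f (-x) = f x) {x : ℝ} (hx : 0 < x) :
    ∑' b : ℤ, (-1 : ℝ) ^ b * f (b * x) = -2 * (sumS f x - 2 * sumS f (2 * x)) := by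
  have h := alt_nat hf hx
  have := HasSum.of_add_one_of_neg_add_one (f := fun b : ℤ => (-1 : ℝ) ^ b * f (b * x))
    (m := -(sumS f x - 2 * sumS f (2 * x))) (m' := -(sumS f x - 2 * sumS f (2 * x)))
    (by
      convert h using 2 with n
      push_cast
      rw [← zpow_natCast]; push_cast; rfl)
    (by
      convert h using 2 with n
      rw [zpow_neg, ← inv_zpow, show ((-1 : ℝ)⁻¹) = -1 by norm_num]
      push_cast
      rw [neg_mul, he]
      rw [← zpow_natCast]; push_cast; rfl)
  rw [this.tsum_eq]
  simp [h0]; ring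

lemma telescope (g : ℝ → ℝ) (hg : Filter.Tendsto g (nhdsWithin 0 (Set.Ioi 0)) (nhds 0)) (C : ℝ)
    (K : ℕ) (hK : 1 ≤ K) (h : ∀ ε, 0 < ε → ε ≤ 1 → |g ε - g (2 * ε)| ≤ C * ε ^ K) :
    ∀ ε, 0 < ε → ε ≤ 1 → |g ε| ≤ C * ε ^ K := by
  have hC : 0 ≤ C := by
    have := (abs_nonneg _).trans (h 1 one_pos le_rfl); simpa using this
  intro ε h0 h1
  have st : ∀ n : ℕ, |g ε - g (ε * (1 / 2) ^ n)| ≤ C * ε ^ K * (1 - (1 / 2) ^ n) := by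
    intro n
    induction n with
    | zero => simp
    | succ n ih =>
      have hp : (0:ℝ) < (1 / 2) ^ (n + 1) := by positivity
      have hp1 : ((1:ℝ) / 2) ^ (n + 1) ≤ 1 := pow_le_one₀ (by norm_num) (by norm_num)
      have a := h (ε * (1 / 2) ^ (n + 1)) (by positivity) (by nlinarith)
      have b : 2 * (ε * (1 / 2) ^ (n + 1)) = ε * (1 / 2) ^ n := by rw [pow_succ]; ring
      rw [b, mul_pow] at a
      have c : (((1:ℝ) / 2) ^ (n + 1)) ^ K ≤ (1 / 2) ^ (n + 1) :=
        pow_le_of_le_one hp.le hp1 (by omega)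
      have d : C * (ε ^ K * ((1 / 2) ^ (n + 1)) ^ K) ≤ C * ε ^ K * (1 / 2) ^ (n + 1) := by
        rw [mul_assoc]; gcongr
      have e : g ε - g (ε * (1 / 2) ^ (n + 1)) = (g ε - g (ε * (1 / 2) ^ n)) -
        (g (ε * (1 / 2) ^ (n + 1)) - g (ε * (1 / 2) ^ n)) := by ring
      rw [e]
      refine (abs_sub _ _).trans ((add_le_add ih (a.trans d)).trans (le_of_eq ?_))
      rw [pow_succ]; ring
  have lim : Filter.Tendsto (fun n : ℕ => ε * (1 / 2 : ℝ) ^ n) Filter.atTop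
      (nhdsWithin 0 (Set.Ioi 0)) := by
    refine tendsto_nhdsWithin_iff.2 ⟨?_, Filter.Eventually.of_forall fun n => ?_⟩
    · have := (tendsto_pow_atTop_nhds_zero_of_lt_one (r := (1/2 : ℝ)) (by norm_num) (by norm_num)).const_mul ε
      simpa using this
    · simp only [Set.mem_Ioi]; positivity
  have l2 := ((hg.comp lim).const_sub (g ε)).abs
  rw [sub_zero] at l2
  refine le_of_tendsto l2 (Filter.Eventually.of_forall fun n => (st n).trans ?_)
  have : (0:ℝ) < (1 / 2) ^ n := by positivity
  have : 0 ≤ C * ε ^ K := by positivity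
  nlinarith

lemma gP_decay (P : Polynomial ℝ) : ∃ C, 0 ≤ C ∧ ∀ x, 0 < x → |gP P x| ≤ C / x ^ 2 := by
  obtain ⟨C, hC, h⟩ := gP_bdd_sq P
  refine ⟨C, hC, fun x hx => (h x).trans ?_⟩
  gcongr
  linarith

noncomputable def Phi (P : Polynomial ℝ) : ℝ → ℝ := sumS (gP P)
noncomputable def DD (P : Polynomial ℝ) : ℝ → ℝ := sumS (Phi P)

lemma Phi_decay (P : Polynomial ℝ) : ∃ C, ∀ x, 0 < x → |Phi P x| ≤ C / x ^ 2 := by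
  obtain ⟨C, -, h⟩ := gP_decay P
  exact ⟨_, sumS_bound h⟩

lemma psi_eq_Phi (P : Polynomial ℝ) (hP : P.eval 0 = 0) (he : ∀ x, P.eval (-x) = P.eval x)
    {x : ℝ} (hx : 0 < x) : psi P 0 x = -2 * (Phi P x - 2 * Phi P (2 * x)) := by
  obtain ⟨C, -, h⟩ := gP_decay P
  have := alt_split h (by simp [gP, hP]) (fun x => by simp [gP, he]) hx
  rw [psi, if_neg hx.ne', Phi, ← this]
  simp

lemma sumS_psi (P : Polynomial ℝ) (hP : P.eval 0 = 0) (he : ∀ x, P.eval (-x) = P.eval x)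
    {x : ℝ} (hx : 0 < x) : sumS (psi P 0) x = -2 * (DD P x - 2 * DD P (2 * x)) := by
  obtain ⟨C, h⟩ := Phi_decay P
  have h1 := sumS_summable h hx
  have h2 := sumS_summable h (show 0 < 2 * x by positivity)
  rw [DD, sumS, sumS, sumS, ← tsum_mul_left, ← h1.tsum_sub (h2.mul_left 2), ← tsum_mul_left]
  refine tsum_congr fun n => ?_
  rw [psi_eq_Phi P hP he (by positivity)]
  ring_nf

lemma Phi_asymp (P : Polynomial ℝ) (hP : P.eval 0 = 0) (he : ∀ x, P.eval (-x) = P.eval x) (I : ℝ)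
    (hI : Filter.Tendsto (fun ε => ε * Phi P ε) (nhdsWithin 0 (Set.Ioi 0)) (nhds I)) (K : ℕ)
    (hK : 1 ≤ K) :
    ∃ C, ∀ ε, 0 < ε → ε ≤ 1 → |ε * Phi P ε - I| ≤ C * ε ^ K := by
  obtain ⟨C, hC, h⟩ := gP_alt P K
  obtain ⟨C', -, h'⟩ := gP_decay P
  refine ⟨C, telescope _ (by simpa using hI.sub_const I) C K hK fun ε h0 h1 => ?_⟩
  have a := h ε h0 h1
  rw [alt_split h' (by simp [gP, hP]) (fun x => by simp [gP, he]) h0, abs_mul] at a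
  have e : ε * Phi P ε - I - (2 * ε * Phi P (2 * ε) - I) =
    ε * (sumS (gP P) ε - 2 * sumS (gP P) (2 * ε)) := by rw [Phi]; ring
  rw [e, abs_mul, abs_of_pos h0]
  rw [abs_neg, abs_two] at a
  nlinarith [abs_nonneg (sumS (gP P) ε - 2 * sumS (gP P) (2 * ε))]

lemma DD_asymp (P : Polynomial ℝ) (hP : P.eval 0 = 0) (he : ∀ x, P.eval (-x) = P.eval x) (I B : ℝ)
    (hI : Filter.Tendsto (fun ε => ε * DD P ε + I * Real.log ε) (nhdsWithin 0 (Set.Ioi 0)) (nhds B))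
    (K : ℕ) (hK : 1 ≤ K) :
    ∃ C, ∀ ε, 0 < ε → ε ≤ 1 → |ε * DD P ε + I * Real.log ε - B| ≤ C * ε ^ K := by
  obtain ⟨C, hC, h⟩ := psi_alt P hP K
  obtain ⟨C', hC', h'⟩ := psi_bound P hP 0
  have h'' : ∀ x, 0 < x → |psi P 0 x| ≤ C' / x ^ 2 := fun x hx => (h' x).trans (by
    gcongr
    linarith)
  have hW : Filter.Tendsto (fun ε => ε * DD P ε + I * Real.log ε - B) (nhdsWithin 0 (Set.Ioi 0))
    (nhds 0) := by simpa using hI.sub_const B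
  have dbl : Filter.Tendsto (fun ε : ℝ => 2 * ε) (nhdsWithin 0 (Set.Ioi 0))
      (nhdsWithin 0 (Set.Ioi 0)) := by
    refine tendsto_nhdsWithin_iff.2 ⟨?_, ?_⟩
    · have : Filter.Tendsto (fun ε : ℝ => 2 * ε) (nhds 0) (nhds (2 * 0)) :=
        (continuous_const.mul continuous_id).tendsto 0
      rw [mul_zero] at this
      exact this.mono_left nhdsWithin_le_nhds
    · filter_upwards [self_mem_nhdsWithin] with x hx
      simp only [Set.mem_Ioi] at hx ⊢; positivity
  set W : ℝ → ℝ := fun ε => ε * DD P ε + I * Real.log ε - B with hWd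
  have hV : Filter.Tendsto (fun ε => W ε - W (2 * ε)) (nhdsWithin 0 (Set.Ioi 0)) (nhds 0) := by
    simpa using hW.sub (hW.comp dbl)
  refine ⟨C, telescope W hW C K hK (telescope (fun ε => W ε - W (2 * ε)) hV C K hK ?_)⟩
  intro ε h0 h1
  have a := h ε h0 h1
  rw [alt_split h'' (by simp [psi]) (fun x => by simp [psi_neg]) h0,
    sumS_psi P hP he h0, sumS_psi P hP he (by positivity)] at a
  have e : W ε - W (2 * ε) - (W (2 * ε) - W (2 * (2 * ε))) = (ε / 4) *
      (-2 * (-2 * (DD P ε - 2 * DD P (2 * ε)) - 2 * (-2 * (DD P (2 * ε) -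
        2 * DD P (2 * (2 * ε)))))) := by
    simp only [hWd]
    rw [Real.log_mul (y := 2 * ε) two_ne_zero (by positivity),
      Real.log_mul (y := ε) two_ne_zero h0.ne']
    ring
  rw [e, abs_mul, abs_of_pos (by positivity)]
  refine le_trans (mul_le_of_le_one_left (abs_nonneg _) (by linarith)) a


lemma riemann_sum (R : ℝ → ℝ) (hR : ContinuousOn R (Set.Ioi 0)) (C : ℝ) (hC : 0 ≤ C)
    (hb : ∀ x, 0 < x → |R x| ≤ C / (1 + x ^ 2)) :
    Filter.Tendsto (fun ε => ε * sumS R ε) (nhdsWithin 0 (Set.Ioi 0))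
      (nhds (∫ x in Set.Ioi (0 : ℝ), R x)) := by
  set F : ℝ → ℝ → ℝ := fun ε x => R ((⌈x / ε⌉₊ : ℝ) * ε) with hF
  have hIntg : MeasureTheory.IntegrableOn (fun x : ℝ => C / (1 + x ^ 2)) (Set.Ioi 0) := by
    have := (integrable_inv_one_add_sq.const_mul C).integrableOn (s := Set.Ioi 0)
    simpa [div_eq_mul_inv] using this
  have hmeas : ∀ ε, MeasureTheory.AEStronglyMeasurable (F ε)
      (MeasureTheory.volume.restrict (Set.Ioi 0)) := by
    intro ε
    have h1 : Measurable (fun n : ℕ => R ((n : ℝ) * ε)) := measurable_from_top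
    have h2 : Measurable (fun x : ℝ => ⌈x / ε⌉₊) := Nat.measurable_ceil.comp (measurable_id.div_const ε)
    exact (h1.comp h2).aestronglyMeasurable
  have hbd : ∀ ε, 0 < ε → ∀ x ∈ Set.Ioi (0 : ℝ), ‖F ε x‖ ≤ C / (1 + x ^ 2) := by
    intro ε h0 x hx
    have hx' : 0 < x := hx
    have h1 : x ≤ (⌈x / ε⌉₊ : ℝ) * ε := by
      rw [← div_le_iff₀ h0]; exact Nat.le_ceil _
    refine (hb _ (lt_of_lt_of_le hx' h1)).trans ?_
    gcongr
  have lim : Filter.Tendsto (fun ε => ∫ x in Set.Ioi (0 : ℝ), F ε x) (nhdsWithin 0 (Set.Ioi 0))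
      (nhds (∫ x in Set.Ioi (0 : ℝ), R x)) := by
    refine MeasureTheory.tendsto_integral_filter_of_dominated_convergence (fun x => C / (1 + x ^ 2))
      (Filter.Eventually.of_forall hmeas) ?_ hIntg ?_
    · filter_upwards [self_mem_nhdsWithin] with ε hε
      exact (MeasureTheory.ae_restrict_iff' measurableSet_Ioi).2 (Filter.Eventually.of_forall (hbd ε hε))
    · refine (MeasureTheory.ae_restrict_iff' measurableSet_Ioi).2 (Filter.Eventually.of_forall fun x hx => ?_)
      have hx' : 0 < x := hx
      have hc : ContinuousAt R x := hR.continuousAt (Ioi_mem_nhds hx')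
      refine hc.tendsto.comp ?_
      have u : Filter.Tendsto (fun ε : ℝ => x + ε) (nhdsWithin 0 (Set.Ioi 0)) (nhds x) := by
        have : Filter.Tendsto (fun ε : ℝ => x + ε) (nhds 0) (nhds (x + 0)) :=
          (continuous_const.add continuous_id).tendsto 0
        rw [add_zero] at this
        exact this.mono_left nhdsWithin_le_nhds
      refine tendsto_of_tendsto_of_tendsto_of_le_of_le' tendsto_const_nhds u ?_ ?_
      · filter_upwards [self_mem_nhdsWithin] with ε hε
        have h0 : 0 < ε := hε
        rw [← div_le_iff₀ h0]; exact Nat.le_ceil _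
      · filter_upwards [self_mem_nhdsWithin] with ε hε
        have h0 : 0 < ε := hε
        have := (Nat.ceil_lt_add_one (show 0 ≤ x / ε by positivity)).le
        calc (⌈x / ε⌉₊ : ℝ) * ε ≤ (x / ε + 1) * ε := by gcongr
          _ = x + ε := by field_simp
  refine lim.congr' ?_
  filter_upwards [self_mem_nhdsWithin] with ε hε
  have h0 : 0 < ε := hε
  have hU : (⋃ n : ℕ, Set.Ioc ((n : ℝ) * ε) (((n : ℝ) + 1) * ε)) = Set.Ioi 0 := by
    ext x
    simp only [Set.mem_iUnion, Set.mem_Ioc, Set.mem_Ioi]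
    constructor
    · rintro ⟨n, h1, -⟩
      exact lt_of_le_of_lt (by positivity) h1
    · intro hx
      have hpos : 0 < ⌈x / ε⌉₊ := Nat.ceil_pos.2 (by positivity)
      refine ⟨⌈x / ε⌉₊ - 1, ?_, ?_⟩
      · rw [Nat.cast_sub hpos, ← lt_div_iff₀ h0]
        have := Nat.ceil_lt_add_one (show 0 ≤ x / ε by positivity)
        push_cast; linarith
      · rw [Nat.cast_sub hpos, ← div_le_iff₀ h0]
        have := Nat.le_ceil (x / ε)
        push_cast; linarith
  have hval : ∀ n : ℕ, ∫ x in Set.Ioc ((n : ℝ) * ε) (((n : ℝ) + 1) * ε), F ε x =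
      ε * R (((n : ℝ) + 1) * ε) := by
    intro n
    have : ∀ x ∈ Set.Ioc ((n : ℝ) * ε) (((n : ℝ) + 1) * ε), F ε x = R (((n : ℝ) + 1) * ε) := by
      intro x hx
      have : ⌈x / ε⌉₊ = n + 1 := by
        rw [Nat.ceil_eq_iff (by omega)]
        rw [lt_div_iff₀ h0, div_le_iff₀ h0]
        simpa using hx
      simp only [hF, this]; push_cast; rfl
    rw [MeasureTheory.setIntegral_congr_fun measurableSet_Ioc this]
    have e : ((n : ℝ) + 1) * ε - n * ε = ε := by ring
    simp [MeasureTheory.measureReal_def, e, h0.le]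
  have hI : MeasureTheory.IntegrableOn (F ε) (Set.Ioi 0) :=
    MeasureTheory.Integrable.mono' hIntg (hmeas ε)
      ((MeasureTheory.ae_restrict_iff' measurableSet_Ioi).2 (Filter.Eventually.of_forall (hbd ε h0)))
  have := MeasureTheory.hasSum_integral_iUnion (f := F ε) (μ := MeasureTheory.volume)
    (s := fun n : ℕ => Set.Ioc ((n : ℝ) * ε) (((n : ℝ) + 1) * ε)) (fun n => measurableSet_Ioc)
    (by
      have mono : Monotone (fun n : ℕ => (n : ℝ) * ε) := fun a b hab => by
        simp only; gcongr
      have := mono.pairwise_disjoint_on_Ioc_succ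
      simpa using this) (by rw [hU]; exact hI)
  rw [hU] at this
  simp only [hval] at this
  rw [← this.tsum_eq, tsum_mul_left, sumS]

lemma gP_cont (P : Polynomial ℝ) : Continuous (gP P) := by
  unfold gP
  exact P.continuous.mul (by fun_prop)

lemma Phi_cont (P : Polynomial ℝ) : ContinuousOn (Phi P) (Set.Ioi 0) := by
  intro x hx
  have hx' : 0 < x := hx
  obtain ⟨C, hC, h⟩ := gP_decay P
  have : ContinuousOn (Phi P) (Set.Ioi (x / 2)) := by
    unfold Phi sumS
    refine continuousOn_tsum (u := fun n : ℕ => C / (x / 2) ^ 2 * (1 / ((n : ℝ) + 1) ^ 2))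
      (fun n => ((gP_cont P).comp (by fun_prop)).continuousOn) (summable_nat_sq.mul_left _) ?_
    intro n y hy
    have hy' : x / 2 < y := hy
    refine (sumS_term h (by linarith) n).trans ?_
    gcongr
  exact (this.continuousAt (Ioi_mem_nhds (by linarith))).continuousWithinAt

lemma Phi_lim (P : Polynomial ℝ) :
    Filter.Tendsto (fun ε => ε * Phi P ε) (nhdsWithin 0 (Set.Ioi 0))
      (nhds (∫ x in Set.Ioi (0 : ℝ), gP P x)) := by
  obtain ⟨C, hC, h⟩ := gP_bdd_sq P
  exact riemann_sum (gP P) (gP_cont P).continuousOn C hC (fun x _ => h x)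

noncomputable def RR (P : Polynomial ℝ) (I x : ℝ) : ℝ := Phi P x - I * (Real.exp (-x) / x)

lemma RR_cont (P : Polynomial ℝ) (I : ℝ) : ContinuousOn (RR P I) (Set.Ioi 0) := by
  unfold RR
  refine (Phi_cont P).sub (continuousOn_const.mul (ContinuousOn.div (by fun_prop) (by fun_prop) ?_))
  intro x hx
  exact (ne_of_gt hx)

lemma RR_bound (P : Polynomial ℝ) (hP : P.eval 0 = 0) (he : ∀ x, P.eval (-x) = P.eval x) (I : ℝ)
    (hI : ∫ x in Set.Ioi (0 : ℝ), gP P x = I) :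
    ∃ C, 0 ≤ C ∧ ∀ x, 0 < x → |RR P I x| ≤ C / (1 + x ^ 2) := by
  obtain ⟨A, hA⟩ := Phi_asymp P hP he I (hI ▸ Phi_lim P) 1 le_rfl
  obtain ⟨B, hB⟩ := Phi_decay P
  have hA0 : 0 ≤ A := by simpa using (abs_nonneg _).trans (hA 1 one_pos le_rfl)
  have hB0 : 0 ≤ B := by simpa using (abs_nonneg _).trans (hB 1 one_pos)
  refine ⟨2 * (A + |I|) + 2 * (B + |I|), by positivity, fun x hx => ?_⟩
  rw [le_div_iff₀ (by positivity)]
  have e1 : 1 - x ≤ Real.exp (-x) := by have := Real.add_one_le_exp (-x); linarith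
  have e2 : Real.exp (-x) ≤ 1 := Real.exp_le_one_iff.2 (by linarith)
  have e0 := Real.exp_pos (-x)
  rcases le_total x 1 with h | h
  · have h1 := hA x hx h
    have h2 : |RR P I x| ≤ A + |I| := by
      have : x * RR P I x = (x * Phi P x - I) + I * (1 - Real.exp (-x)) := by
        rw [RR]; field_simp; ring
      have h3 : |x * RR P I x| ≤ A * x + |I| * x := by
        rw [this]
        refine (abs_add_le _ _).trans (add_le_add (by simpa using h1) ?_)
        rw [abs_mul]
        gcongr
        rw [abs_of_nonneg (by linarith)]
        linarith
      rw [abs_mul, abs_of_pos hx] at h3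
      refine le_of_mul_le_mul_left ?_ hx
      linarith
    have : x ^ 2 ≤ 1 := pow_le_one₀ hx.le h
    have : 0 ≤ |I| := abs_nonneg I
    nlinarith [abs_nonneg (RR P I x)]
  · have h1 := hB x hx
    have hx2 : 1 ≤ x ^ 2 := one_le_pow₀ h
    have h2 : |RR P I x| ≤ (B + |I|) / x ^ 2 := by
      rw [RR, add_div]
      refine (abs_sub _ _).trans (add_le_add h1 ?_)
      rw [abs_mul, div_eq_mul_one_div |I|, abs_of_pos (a := Real.exp (-x) / x) (by positivity)]
      refine mul_le_mul_of_nonneg_left ?_ (abs_nonneg I)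
      rw [div_le_div_iff₀ hx (by positivity)]
      have : Real.exp (-x) * x ≤ 1 := by
        have h5 := Real.add_one_le_exp x
        have h6 : Real.exp (-x) * Real.exp x = 1 := by rw [← Real.exp_add]; simp
        nlinarith
      nlinarith
    rw [le_div_iff₀ (by positivity)] at h2
    have : 0 ≤ |I| := abs_nonneg I
    nlinarith [abs_nonneg (RR P I x)]

lemma DD_lim (P : Polynomial ℝ) (hP : P.eval 0 = 0) (he : ∀ x, P.eval (-x) = P.eval x) (I : ℝ)
    (hI : ∫ x in Set.Ioi (0 : ℝ), gP P x = I) :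
    Filter.Tendsto (fun ε => ε * DD P ε + I * Real.log ε) (nhdsWithin 0 (Set.Ioi 0))
      (nhds (∫ x in Set.Ioi (0 : ℝ), RR P I x)) := by
  obtain ⟨C, hC, h⟩ := RR_bound P hP he I hI
  obtain ⟨B, hB⟩ := Phi_decay P
  have l1 := riemann_sum (RR P I) (RR_cont P I) C hC h
  have l2 : Filter.Tendsto (fun ε : ℝ => I * Real.log ((1 - Real.exp (-ε)) / ε))
      (nhdsWithin 0 (Set.Ioi 0)) (nhds 0) := by
    have d : HasDerivAt (fun ε : ℝ => 1 - Real.exp (-ε)) 1 0 := by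
      have := ((hasDerivAt_id (0 : ℝ)).neg.exp).const_sub 1
      simpa using this
    have s := d.tendsto_slope_zero_right
    simp only [zero_add, neg_zero, Real.exp_zero, sub_self, sub_zero, smul_eq_mul] at s
    have := ((Real.continuousAt_log one_ne_zero).tendsto.comp s).const_mul I
    rw [Real.log_one, mul_zero] at this
    refine this.congr fun ε => ?_
    simp only [Function.comp]
    rw [inv_mul_eq_div]
  have l3 := l1.sub l2
  rw [sub_zero] at l3
  refine l3.congr' ?_
  filter_upwards [self_mem_nhdsWithin] with ε hε
  have h0 : 0 < ε := hε
  have e2 : Real.exp (-ε) < 1 := by rw [← Real.exp_zero]; exact Real.exp_lt_exp.2 (by linarith)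
  have hs := Real.hasSum_pow_div_log_of_abs_lt_one (x := Real.exp (-ε))
    (by rw [abs_of_pos (Real.exp_pos _)]; exact e2)
  have hD := (sumS_summable hB h0).hasSum
  have := (hD.sub (hs.mul_left (I / ε))).tsum_eq
  have e : sumS (RR P I) ε = DD P ε - I / ε * -Real.log (1 - Real.exp (-ε)) := by
    rw [DD, sumS, sumS, ← this]
    refine tsum_congr fun n => ?_
    rw [RR, ← Real.exp_nat_mul]
    push_cast
    rw [mul_neg]
    field_simp
  rw [e, Real.log_div (by linarith) h0.ne']
  field_simp
  ring


lemma zeta_lim : Filter.Tendsto (fun s : ℝ => (∑' n : ℕ, 1 / ((n : ℝ) + 1) ^ (1 + s)) - 1 / s)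
    (nhdsWithin 0 (Set.Ioi 0)) (nhds Real.eulerMascheroniConstant) := by
  have h1 : Filter.Tendsto ZetaAsymptotics.termTSum (nhdsWithin 1 (Set.Ici 1))
      (nhds (ZetaAsymptotics.termTSum 1)) :=
    ZetaAsymptotics.continuousOn_termTSum 1 (Set.mem_Ici.2 le_rfl)
  have e1 : ZetaAsymptotics.termTSum 1 = 1 - Real.eulerMascheroniConstant :=
    ZetaAsymptotics.term_tsum_one.tsum_eq
  rw [e1] at h1
  have sh : Filter.Tendsto (fun s : ℝ => 1 + s) (nhdsWithin 0 (Set.Ioi 0)) (nhds 1) := by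
    have : Filter.Tendsto (fun s : ℝ => 1 + s) (nhds 0) (nhds (1 + 0)) :=
      (continuous_const.add continuous_id).tendsto 0
    rw [add_zero] at this
    exact this.mono_left nhdsWithin_le_nhds
  have sh' : Filter.Tendsto (fun s : ℝ => 1 + s) (nhdsWithin 0 (Set.Ioi 0))
      (nhdsWithin 1 (Set.Ici 1)) := by
    refine tendsto_nhdsWithin_iff.2 ⟨sh, ?_⟩
    filter_upwards [self_mem_nhdsWithin] with s hs
    have : 0 < s := hs
    simp only [Set.mem_Ici]; linarith
  have l := (sh.mul (h1.comp sh')).const_sub 1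
  rw [one_mul, sub_sub_cancel] at l
  refine l.congr' ?_
  filter_upwards [self_mem_nhdsWithin] with s hs
  have h0 : 0 < s := hs
  have := ZetaAsymptotics.zeta_limit_aux1 (s := 1 + s) (by linarith)
  rw [add_sub_cancel_left] at this
  exact this.symm

lemma gamma_lim : Filter.Tendsto (fun s : ℝ => Real.Gamma s - 1 / s)
    (nhdsWithin 0 (Set.Ioi 0)) (nhds (-Real.eulerMascheroniConstant)) := by
  have := Real.hasDerivAt_Gamma_one.tendsto_slope_zero_right
  refine this.congr' ?_
  filter_upwards [self_mem_nhdsWithin] with s hs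
  have h0 : 0 < s := hs
  rw [add_comm, Real.Gamma_add_one h0.ne', Real.Gamma_one, smul_eq_mul]
  field_simp

lemma rpow_bound {C x s : ℝ} (hC : 0 ≤ C) (hx : 0 < x) (hs : 0 ≤ s) (hs' : s ≤ 1 / 2) :
    x ^ s * (C / (1 + x ^ 2)) ≤ C * (1 + ‖x‖ ^ 2) ^ (-(3 / 2 : ℝ) / 2) := by
  rw [Real.norm_of_nonneg hx.le]
  have h1 : x ^ s ≤ (1 + x ^ 2) ^ (1 / 4 : ℝ) := by
    rcases le_total x 1 with h | h
    · refine (Real.rpow_le_one hx.le h hs).trans (Real.one_le_rpow ?_ (by norm_num))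
      nlinarith
    · refine (Real.rpow_le_rpow_of_exponent_le h hs').trans ?_
      have : x ^ (1 / 2 : ℝ) = (x ^ 2) ^ (1 / 4 : ℝ) := by
        rw [← Real.rpow_natCast, ← Real.rpow_mul hx.le]; norm_num
      rw [this]
      gcongr
      linarith
  have hp : 0 < 1 + x ^ 2 := by positivity
  have e : (1 + x ^ 2) ^ (-(3 / 2 : ℝ) / 2) = (1 + x ^ 2) ^ (1 / 4 : ℝ) * (1 / (1 + x ^ 2)) := by
    rw [one_div (1 + x ^ 2), ← Real.rpow_neg_one (1 + x ^ 2), ← Real.rpow_add hp]; norm_num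
  rw [e]
  calc x ^ s * (C / (1 + x ^ 2)) ≤ (1 + x ^ 2) ^ (1 / 4 : ℝ) * (C / (1 + x ^ 2)) := by gcongr
    _ = _ := by ring

lemma bound_integrable (C : ℝ) : MeasureTheory.IntegrableOn
    (fun x : ℝ => C * (1 + ‖x‖ ^ 2) ^ (-(3 / 2 : ℝ) / 2)) (Set.Ioi 0) := by
  refine MeasureTheory.Integrable.integrableOn (MeasureTheory.Integrable.const_mul ?_ C)
  exact integrable_rpow_neg_one_add_norm_sq (by simp; norm_num)

lemma rpow_meas {f : ℝ → ℝ} (hf : ContinuousOn f (Set.Ioi 0)) (s : ℝ) :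
    MeasureTheory.AEStronglyMeasurable (fun x : ℝ => x ^ s * f x)
      (MeasureTheory.volume.restrict (Set.Ioi 0)) := by
  refine ContinuousOn.aestronglyMeasurable (ContinuousOn.mul ?_ hf) measurableSet_Ioi
  intro x hx
  exact (Real.continuousAt_rpow_const x s (Or.inl (ne_of_gt hx))).continuousWithinAt

lemma rpow_integrable {f : ℝ → ℝ} (hf : ContinuousOn f (Set.Ioi 0)) {C : ℝ} (hC : 0 ≤ C)
    (hb : ∀ x, 0 < x → |f x| ≤ C / (1 + x ^ 2)) {s : ℝ} (hs : 0 ≤ s) (hs' : s ≤ 1 / 2) :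
    MeasureTheory.IntegrableOn (fun x : ℝ => x ^ s * f x) (Set.Ioi 0) := by
  refine MeasureTheory.Integrable.mono' (bound_integrable C) (rpow_meas hf s) ?_
  refine (MeasureTheory.ae_restrict_iff' measurableSet_Ioi).2 (Filter.Eventually.of_forall fun x hx => ?_)
  have hx' : 0 < x := hx
  refine le_trans ?_ (rpow_bound hC hx' hs hs')
  rw [norm_mul, Real.norm_of_nonneg (by positivity)]
  exact mul_le_mul_of_nonneg_left (hb x hx') (by positivity)

lemma rpow_tendsto {f : ℝ → ℝ} (hf : ContinuousOn f (Set.Ioi 0)) {C : ℝ} (hC : 0 ≤ C)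
    (hb : ∀ x, 0 < x → |f x| ≤ C / (1 + x ^ 2)) :
    Filter.Tendsto (fun s : ℝ => ∫ x in Set.Ioi (0 : ℝ), x ^ s * f x) (nhdsWithin 0 (Set.Ioi 0))
      (nhds (∫ x in Set.Ioi (0 : ℝ), f x)) := by
  refine MeasureTheory.tendsto_integral_filter_of_dominated_convergence _
    (Filter.Eventually.of_forall (rpow_meas hf)) ?_ (bound_integrable C) ?_
  · filter_upwards [Ioc_mem_nhdsGT (show (0 : ℝ) < 1 / 2 by norm_num)] with s hs
    refine (MeasureTheory.ae_restrict_iff' measurableSet_Ioi).2 (Filter.Eventually.of_forall fun x hx => ?_)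
    have hx' : 0 < x := hx
    refine le_trans ?_ (rpow_bound hC hx' hs.1.le hs.2)
    rw [norm_mul, Real.norm_of_nonneg (by positivity)]
    exact mul_le_mul_of_nonneg_left (hb x hx') (by positivity)
  · refine (MeasureTheory.ae_restrict_iff' measurableSet_Ioi).2 (Filter.Eventually.of_forall fun x hx => ?_)
    have hx' : 0 < x := hx
    have : Filter.Tendsto (fun s : ℝ => x ^ s) (nhds 0) (nhds (x ^ (0 : ℝ))) :=
      (Real.continuousAt_const_rpow hx'.ne').tendsto
    have := (this.mono_left (nhdsWithin_le_nhds (s := Set.Ioi 0))).mul_const (f x)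
    simpa using this

lemma mellin_Phi (P : Polynomial ℝ) {s : ℝ} (hs : 0 < s) (hs' : s ≤ 1 / 2) :
    ∫ x in Set.Ioi (0 : ℝ), x ^ s * Phi P x =
      (∑' n : ℕ, 1 / ((n : ℝ) + 1) ^ (1 + s)) * ∫ x in Set.Ioi (0 : ℝ), x ^ s * gP P x := by
  obtain ⟨C, hC, h⟩ := gP_bdd_sq P
  have hi := rpow_integrable (gP_cont P).continuousOn hC (fun x _ => h x) hs.le hs'
  set H : ℝ → ℝ := fun x => x ^ s * gP P x with hH
  have e : ∀ n : ℕ, ∀ x ∈ Set.Ioi (0 : ℝ), x ^ s * gP P (((n : ℝ) + 1) * x) =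
      (((n : ℝ) + 1) ^ s)⁻¹ * H (((n : ℝ) + 1) * x) := by
    intro n x hx
    have hx' : 0 < x := hx
    simp only [hH]
    rw [Real.mul_rpow (by positivity) hx'.le]
    have : 0 < ((n : ℝ) + 1) ^ s := by positivity
    field_simp
  have e3 : ∀ n : ℕ, (((n : ℝ) + 1) ^ s)⁻¹ * ((n : ℝ) + 1)⁻¹ = 1 / ((n : ℝ) + 1) ^ (1 + s) := by
    intro n
    rw [Real.rpow_add (by positivity), Real.rpow_one, one_div, mul_inv, mul_comm]
  have e2 : ∀ n : ℕ, ∫ x in Set.Ioi (0 : ℝ), x ^ s * gP P (((n : ℝ) + 1) * x) =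
      1 / ((n : ℝ) + 1) ^ (1 + s) * ∫ x in Set.Ioi (0 : ℝ), H x := by
    intro n
    rw [MeasureTheory.setIntegral_congr_fun measurableSet_Ioi (e n), MeasureTheory.integral_const_mul,
      MeasureTheory.integral_comp_mul_left_Ioi H 0 (show (0 : ℝ) < n + 1 by positivity), mul_zero,
      smul_eq_mul, ← mul_assoc, e3]
  have e4 : ∀ n : ℕ, ∫ x in Set.Ioi (0 : ℝ), ‖x ^ s * gP P (((n : ℝ) + 1) * x)‖ =
      1 / ((n : ℝ) + 1) ^ (1 + s) * ∫ x in Set.Ioi (0 : ℝ), ‖H x‖ := by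
    intro n
    have : ∀ x ∈ Set.Ioi (0 : ℝ), ‖x ^ s * gP P (((n : ℝ) + 1) * x)‖ =
      (((n : ℝ) + 1) ^ s)⁻¹ * ‖H (((n : ℝ) + 1) * x)‖ := by
      intro x hx
      rw [e n x hx, norm_mul, Real.norm_of_nonneg (by positivity)]
    rw [MeasureTheory.setIntegral_congr_fun measurableSet_Ioi this, MeasureTheory.integral_const_mul,
      MeasureTheory.integral_comp_mul_left_Ioi (fun y => ‖H y‖) 0 (show (0 : ℝ) < n + 1 by positivity),
      mul_zero, smul_eq_mul, ← mul_assoc, e3]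
  have hz : Summable (fun n : ℕ => 1 / ((n : ℝ) + 1) ^ (1 + s)) := by
    have := (summable_nat_add_iff 1).2 (Real.summable_one_div_nat_rpow.2 (show 1 < 1 + s by linarith))
    simpa using this
  have key := MeasureTheory.hasSum_integral_of_summable_integral_norm
    (μ := MeasureTheory.volume.restrict (Set.Ioi (0 : ℝ)))
    (F := fun (n : ℕ) (x : ℝ) => x ^ s * gP P (((n : ℝ) + 1) * x))
    (fun n => by
      have h1 : MeasureTheory.IntegrableOn (fun x => H (((n : ℝ) + 1) * x)) (Set.Ioi 0) := by
        rw [MeasureTheory.integrableOn_Ioi_comp_mul_left_iff H 0 (show (0 : ℝ) < n + 1 by positivity), mul_zero]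
        exact hi
      have h2 : MeasureTheory.IntegrableOn (fun x => (((n : ℝ) + 1) ^ s)⁻¹ * H (((n : ℝ) + 1) * x))
        (Set.Ioi 0) := MeasureTheory.Integrable.const_mul h1 _
      exact h2.congr_fun (fun x hx => (e n x hx).symm) measurableSet_Ioi)
    (by simp only [e4]; exact hz.mul_right _)
  simp only [e2] at key
  rw [← tsum_mul_right, key.tsum_eq]
  refine MeasureTheory.setIntegral_congr_fun measurableSet_Ioi fun x _ => ?_
  simp only [Phi, sumS, tsum_mul_left]

lemma RR_integral (P : Polynomial ℝ) (hP : P.eval 0 = 0) (he : ∀ x, P.eval (-x) = P.eval x) (I : ℝ)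
    (hI : ∫ x in Set.Ioi (0 : ℝ), gP P x = I) (M : ℝ → ℝ) (L : ℝ)
    (hM : ∀ s, 0 < s → ∫ x in Set.Ioi (0 : ℝ), x ^ s * gP P x = M s) (hM0 : M 0 = I)
    (hL : HasDerivAt M L 0) :
    ∫ x in Set.Ioi (0 : ℝ), RR P I x = L + 2 * Real.eulerMascheroniConstant * I := by
  obtain ⟨C, hC, h⟩ := RR_bound P hP he I hI
  have l1 := rpow_tendsto (RR_cont P I) hC h
  have l2 : Filter.Tendsto M (nhdsWithin 0 (Set.Ioi 0)) (nhds I) := by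
    rw [← hM0]; exact hL.continuousAt.tendsto.mono_left nhdsWithin_le_nhds
  have l3 := hL.tendsto_slope_zero_right
  have l4 := ((zeta_lim.mul l2).add l3).sub (gamma_lim.const_mul I)
  refine (tendsto_nhds_unique (l1.congr' ?_) l4).trans (by ring)
  filter_upwards [Ioc_mem_nhdsGT (show (0 : ℝ) < 1 / 2 by norm_num)] with s hs
  have hs0 : 0 < s := hs.1
  have i1 := rpow_integrable (RR_cont P I) hC h hs0.le hs.2
  have i2 := (Real.GammaIntegral_convergent hs0).const_mul I
  have ex : ∀ x ∈ Set.Ioi (0 : ℝ), x ^ s * Phi P x = x ^ s * RR P I x +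
      I * (Real.exp (-x) * x ^ (s - 1)) := by
    intro x hx
    have hx' : 0 < x := hx
    rw [Real.rpow_sub_one hx'.ne', RR]; ring
  have e1 := mellin_Phi P hs0 hs.2
  rw [MeasureTheory.setIntegral_congr_fun measurableSet_Ioi ex,
    MeasureTheory.integral_add i1 i2, MeasureTheory.integral_const_mul,
    ← Real.Gamma_eq_integral hs0, hM s hs0] at e1
  rw [zero_add, hM0, smul_eq_mul, eq_sub_of_add_eq e1]
  ring


lemma gamma_half_deriv (j : ℕ) : HasDerivAt Real.Gamma
    (Real.Gamma ((j : ℝ) + 1 / 2) * digammaHalf j) ((j : ℝ) + 1 / 2) := by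
  induction j with
  | zero =>
    have := Real.hasDerivAt_Gamma_one_half
    simp only [CharP.cast_eq_zero, zero_add, digammaHalf, Finset.range_zero, Finset.sum_empty]
    refine this.congr_deriv ?_
    rw [Real.Gamma_one_half_eq]; ring
  | succ j ih =>
    have hpos : (0 : ℝ) < (j : ℝ) + 1 / 2 := by positivity
    have h1 : HasDerivAt (fun s : ℝ => s * Real.Gamma s)
        (1 * Real.Gamma ((j : ℝ) + 1 / 2) + ((j : ℝ) + 1 / 2) *
          (Real.Gamma ((j : ℝ) + 1 / 2) * digammaHalf j)) ((j : ℝ) + 1 / 2) :=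
      (hasDerivAt_id _).fun_mul ih
    have e : (((j + 1 : ℕ) : ℝ) + 1 / 2) - 1 = (j : ℝ) + 1 / 2 := by push_cast; ring
    have h2 : HasDerivAt (fun s : ℝ => (s - 1) * Real.Gamma (s - 1))
        (1 * Real.Gamma ((j : ℝ) + 1 / 2) + ((j : ℝ) + 1 / 2) *
          (Real.Gamma ((j : ℝ) + 1 / 2) * digammaHalf j)) (((j + 1 : ℕ) : ℝ) + 1 / 2) := by
      have h1' := h1
      rw [← e] at h1'
      have h4 := h1'.comp_sub_const _ 1
      rw [e] at h4
      exact h4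
    have h3 := h2.congr_of_eventuallyEq (f₁ := Real.Gamma) (by
      have : (1 : ℝ) < ((j + 1 : ℕ) : ℝ) + 1 / 2 := by push_cast; linarith
      filter_upwards [Ioi_mem_nhds this] with s hs
      have hs' : 1 < s := hs
      rw [← Real.Gamma_add_one (by linarith), sub_add_cancel])
    refine h3.congr_deriv ?_
    have e5 : Real.Gamma (((j + 1 : ℕ) : ℝ) + 1 / 2) =
        ((j : ℝ) + 1 / 2) * Real.Gamma ((j : ℝ) + 1 / 2) := by
      rw [← Real.Gamma_add_one hpos.ne']; congr 1; push_cast; ring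
    rw [e5, digammaHalf, digammaHalf, Finset.sum_range_succ]
    have : (2 : ℝ) * j + 1 ≠ 0 := by positivity
    field_simp
    ring

open Polynomial in
noncomputable def PJ (j : ℕ) : ℝ[X] := (2 * X ^ 2 - 1) * X ^ (2 * j)

lemma PJ_eval (j : ℕ) (x : ℝ) : (PJ j).eval x = (2 * x ^ 2 - 1) * x ^ (2 * j) := by
  simp [PJ]

lemma PJ_mellin (j : ℕ) (s : ℝ) (hs : 0 ≤ s) :
    ∫ x in Set.Ioi (0 : ℝ), x ^ s * gP (PJ j) x =
      Real.Gamma (((j : ℝ) + 1 / 2) + s / 2) * ((j : ℝ) + s / 2) := by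
  have i1 := integrableOn_rpow_mul_exp_neg_rpow (p := 2) (s := s + 2 * j + 2)
    (by have : (0:ℝ) ≤ j := by positivity
        linarith) (by norm_num)
  have i2 := integrableOn_rpow_mul_exp_neg_rpow (p := 2) (s := s + 2 * j)
    (by have : (0:ℝ) ≤ j := by positivity
        linarith) (by norm_num)
  have v1 := integral_rpow_mul_exp_neg_rpow (p := 2) (q := s + 2 * j + 2) (by norm_num)
    (by have : (0:ℝ) ≤ j := by positivity
        linarith)
  have v2 := integral_rpow_mul_exp_neg_rpow (p := 2) (q := s + 2 * j) (by norm_num)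
    (by have : (0:ℝ) ≤ j := by positivity
        linarith)
  have ex : ∀ x ∈ Set.Ioi (0 : ℝ), x ^ s * gP (PJ j) x =
      2 * (x ^ (s + 2 * j + 2) * Real.exp (-x ^ (2 : ℝ))) -
        x ^ (s + 2 * j) * Real.exp (-x ^ (2 : ℝ)) := by
    intro x hx
    have hx' : 0 < x := hx
    have e2 : x ^ (2 * (j : ℝ)) = x ^ (2 * j) := by
      rw [← Real.rpow_natCast]; push_cast; rfl
    rw [gP, PJ_eval, Real.rpow_add hx', Real.rpow_add hx', Real.rpow_two, e2]
    ring
  rw [MeasureTheory.setIntegral_congr_fun measurableSet_Ioi ex,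
    MeasureTheory.integral_sub (MeasureTheory.Integrable.const_mul i1 2) i2,
    MeasureTheory.integral_const_mul, v1, v2]
  have hpos : (0 : ℝ) < (j : ℝ) + 1 / 2 + s / 2 := by positivity
  rw [show (s + 2 * (j : ℝ) + 2 + 1) / 2 = ((j : ℝ) + 1 / 2 + s / 2) + 1 by ring,
    Real.Gamma_add_one hpos.ne', show (s + 2 * (j : ℝ) + 1) / 2 = (j : ℝ) + 1 / 2 + s / 2 by ring]
  ring

lemma PJ_asymp (j : ℕ) (hj : 1 ≤ j) (K : ℕ) (hK : 1 ≤ K) (I Q : ℝ)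
    (hI : I = j * Real.Gamma ((j : ℝ) + 1 / 2))
    (hQ : Q = digammaHalf j / 2 + 1 / (2 * (j : ℝ)) + 2 * Real.eulerMascheroniConstant) :
    (∃ C, ∀ ε, 0 < ε → ε ≤ 1 → |ε * Phi (PJ j) ε - I| ≤ C * ε ^ K) ∧
    (∃ C, ∀ ε, 0 < ε → ε ≤ 1 → |ε * DD (PJ j) ε + I * Real.log ε - I * Q| ≤ C * ε ^ K) := by
  have hP : (PJ j).eval 0 = 0 := by
    rw [PJ_eval, zero_pow (by omega : 2 * j ≠ 0), mul_zero]
  have he : ∀ x, (PJ j).eval (-x) = (PJ j).eval x := by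
    intro x
    rw [PJ_eval, PJ_eval, neg_sq, Even.neg_pow (even_two_mul j)]
  have hI0 : ∫ x in Set.Ioi (0 : ℝ), gP (PJ j) x = I := by
    have := PJ_mellin j 0 le_rfl
    simp only [Real.rpow_zero, one_mul, zero_div, add_zero] at this
    rw [this, hI]; ring
  refine ⟨Phi_asymp _ hP he I (hI0 ▸ Phi_lim _) K hK, ?_⟩
  have hd : HasDerivAt (fun s : ℝ => Real.Gamma (((j : ℝ) + 1 / 2) + s / 2) * ((j : ℝ) + s / 2))
      (Real.Gamma ((j : ℝ) + 1 / 2) * digammaHalf j * (1 / 2) * (j : ℝ) +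
        Real.Gamma ((j : ℝ) + 1 / 2) * (1 / 2)) 0 := by
    have a1 : HasDerivAt (fun s : ℝ => ((j : ℝ) + 1 / 2) + s / 2) (1 / 2) 0 :=
      ((hasDerivAt_id (0 : ℝ)).div_const 2).const_add _
    have a2 : HasDerivAt (fun s : ℝ => (j : ℝ) + s / 2) (1 / 2) 0 :=
      ((hasDerivAt_id (0 : ℝ)).div_const 2).const_add _
    have g : HasDerivAt Real.Gamma (Real.Gamma ((j : ℝ) + 1 / 2) * digammaHalf j)
        ((j : ℝ) + 1 / 2 + 0 / 2) := by
      simpa using gamma_half_deriv j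
    have := (g.comp (0 : ℝ) a1).fun_mul a2
    simpa using this
  have hR := RR_integral (PJ j) hP he I hI0 _ _ (fun s hs => PJ_mellin j s hs.le)
    (by simp [hI]; ring) hd
  refine DD_asymp _ hP he I (I * Q) ?_ K hK
  have := DD_lim _ hP he I hI0
  rw [hR] at this
  convert this using 2
  rw [hI, hQ]
  have : (j : ℝ) ≠ 0 := by positivity
  field_simp

lemma core_even (P : Polynomial ℝ) (K : ℕ) (I Q : ℝ)
    (hD : ∃ C, ∀ ε, 0 < ε → ε ≤ 1 → |ε * DD P ε + I * Real.log ε - I * Q| ≤ C * ε ^ K) :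
    ∃ C, ∀ ε, 0 < ε → ε ≤ 1 / 2 →
      |(DD P ε - DD P (2 * ε)) - 1 / ε * (I / 2 * (Q - Real.log ε + Real.log 2))| ≤
        C * ε ^ K / ε := by
  obtain ⟨C, h⟩ := hD
  refine ⟨C + C * 2 ^ K, fun ε h0 h1 => ?_⟩
  have a := h ε h0 (by linarith)
  have b := h (2 * ε) (by linarith) (by linarith)
  rw [Real.log_mul two_ne_zero h0.ne', mul_pow] at b
  have e : (DD P ε - DD P (2 * ε)) - 1 / ε * (I / 2 * (Q - Real.log ε + Real.log 2)) =
    ((ε * DD P ε + I * Real.log ε - I * Q) - 1 / 2 *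
      (2 * ε * DD P (2 * ε) + I * (Real.log 2 + Real.log ε) - I * Q)) / ε := by
    field_simp; ring
  rw [e, abs_div, abs_of_pos h0]
  gcongr
  refine (abs_sub _ _).trans ?_
  rw [abs_mul, abs_of_pos (show (0:ℝ) < 1 / 2 by norm_num)]
  nlinarith [abs_nonneg (2 * ε * DD P (2 * ε) + I * (Real.log 2 + Real.log ε) - I * Q)]

lemma core_odd (P : Polynomial ℝ) (K : ℕ) (I Q : ℝ)
    (hP : ∃ C, ∀ ε, 0 < ε → ε ≤ 1 → |ε * Phi P ε - I| ≤ C * ε ^ K)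
    (hD : ∃ C, ∀ ε, 0 < ε → ε ≤ 1 → |ε * DD P ε + I * Real.log ε - I * Q| ≤ C * ε ^ K) :
    ∃ C, ∀ ε, 0 < ε → ε ≤ 1 / 2 →
      |(DD P (ε / 2) - 2 * DD P ε + DD P (2 * ε) - Phi P (ε / 2) + Phi P ε) -
        1 / ε * (I / 2 * (Q - Real.log ε + 3 * Real.log 2 - 2))| ≤ C * ε ^ K / ε := by
  obtain ⟨C, h⟩ := hD
  obtain ⟨A, g⟩ := hP
  refine ⟨2 * C + 2 * C + C * 2 ^ K + 2 * A + A, fun ε h0 h1 => ?_⟩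
  have hC : 0 ≤ C := by simpa using (abs_nonneg _).trans (h 1 one_pos le_rfl)
  have hA : 0 ≤ A := by simpa using (abs_nonneg _).trans (g 1 one_pos le_rfl)
  have a := h ε h0 (by linarith)
  have b := h (2 * ε) (by linarith) (by linarith)
  have c := h (ε / 2) (by linarith) (by linarith)
  have d := g ε h0 (by linarith)
  have f := g (ε / 2) (by linarith) (by linarith)
  have hle : (ε / 2) ^ K ≤ ε ^ K := by gcongr; linarith
  have c := c.trans (mul_le_mul_of_nonneg_left hle hC)
  have f := f.trans (mul_le_mul_of_nonneg_left hle hA)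
  rw [Real.log_mul two_ne_zero h0.ne', mul_pow] at b
  rw [Real.log_div h0.ne' two_ne_zero] at c
  have e : (DD P (ε / 2) - 2 * DD P ε + DD P (2 * ε) - Phi P (ε / 2) + Phi P ε) -
        1 / ε * (I / 2 * (Q - Real.log ε + 3 * Real.log 2 - 2)) =
    (2 * (ε / 2 * DD P (ε / 2) + I * (Real.log ε - Real.log 2) - I * Q) -
      2 * (ε * DD P ε + I * Real.log ε - I * Q) + 1 / 2 *
      (2 * ε * DD P (2 * ε) + I * (Real.log 2 + Real.log ε) - I * Q)
      - 2 * (ε / 2 * Phi P (ε / 2) - I) + (ε * Phi P ε - I)) / ε := by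
    field_simp; ring
  rw [e, abs_div, abs_of_pos h0]
  gcongr
  rw [abs_le] at a b c d f ⊢
  have : 0 ≤ C * 2 ^ K * ε ^ K := by positivity
  constructor <;> nlinarith

lemma gP_prod_summable (P : Polynomial ℝ) {ε : ℝ} (h0 : 0 < ε) :
    Summable (fun p : ℕ × ℕ => |gP P (upsHK p.1 p.2 * ε)|) := by
  obtain ⟨C, hC, h⟩ := gP_decay P
  have hs := (summable_nat_sq.mul_of_nonneg summable_nat_sq (fun n => by positivity)
    (fun n => by positivity)).mul_left (4 * C / ε ^ 2)
  refine Summable.of_nonneg_of_le (fun p => abs_nonneg _) (fun p => ?_) hs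
  have hu : ((p.1 : ℝ) + 1) * ((p.2 : ℝ) + 1) / 2 ≤ upsHK p.1 p.2 := by
    unfold upsHK
    have : (0 : ℝ) ≤ p.1 := by positivity
    have : (0 : ℝ) ≤ p.2 := by positivity
    gcongr <;> linarith
  have hu0 : 0 < upsHK p.1 p.2 := lt_of_lt_of_le (by positivity) hu
  refine (h _ (by positivity)).trans ?_
  calc C / (upsHK p.1 p.2 * ε) ^ 2 ≤ C / (((p.1 : ℝ) + 1) * ((p.2 : ℝ) + 1) / 2 * ε) ^ 2 := by gcongr
    _ = _ := by field_simp; norm_num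

lemma inner_even (P : Polynomial ℝ) {ε : ℝ} (h0 : 0 < ε) (a : ℕ) :
    ∑' k : ℕ, gP P (upsHK (2 * a) k * ε) =
      Phi P (((a : ℝ) + 1) * ε) - Phi P (((a : ℝ) + 1) * (2 * ε)) := by
  obtain ⟨C, hC, h⟩ := gP_decay P
  have := odd_split h (show 0 < ((a : ℝ) + 1) * ε by positivity)
  rw [Phi, show ((a : ℝ) + 1) * (2 * ε) = 2 * (((a : ℝ) + 1) * ε) by ring, ← this]
  refine tsum_congr fun k => ?_
  congr 1; unfold upsHK; push_cast; ring

lemma inner_odd (P : Polynomial ℝ) {ε : ℝ} (h0 : 0 < ε) (a : ℕ) :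
    ∑' k : ℕ, gP P (upsHK (2 * a + 1) k * ε) =
      Phi P ((2 * ((a + 1 : ℕ) : ℝ) + 1) * (ε / 2)) - Phi P ((2 * ((a + 1 : ℕ) : ℝ) + 1) * ε) := by
  obtain ⟨C, hC, h⟩ := gP_decay P
  have := odd_split h (show 0 < (2 * ((a + 1 : ℕ) : ℝ) + 1) * (ε / 2) by positivity)
  rw [Phi, show (2 * ((a + 1 : ℕ) : ℝ) + 1) * ε = 2 * ((2 * ((a + 1 : ℕ) : ℝ) + 1) * (ε / 2)) by ring,
    ← this]
  refine tsum_congr fun k => ?_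
  congr 1; unfold upsHK; push_cast; ring

lemma outer_even (P : Polynomial ℝ) {ε : ℝ} (h0 : 0 < ε) :
    ∑' a : ℕ, (Phi P (((a : ℝ) + 1) * ε) - Phi P (((a : ℝ) + 1) * (2 * ε))) =
      DD P ε - DD P (2 * ε) := by
  obtain ⟨C, h⟩ := Phi_decay P
  rw [(sumS_summable h h0).tsum_sub (sumS_summable h (by positivity))]
  rfl

lemma outer_odd (P : Polynomial ℝ) {ε : ℝ} (h0 : 0 < ε) :
    ∑' a : ℕ, (Phi P ((2 * ((a + 1 : ℕ) : ℝ) + 1) * (ε / 2)) -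
        Phi P ((2 * ((a + 1 : ℕ) : ℝ) + 1) * ε)) =
      DD P (ε / 2) - 2 * DD P ε + DD P (2 * ε) - Phi P (ε / 2) + Phi P ε := by
  obtain ⟨C, h⟩ := Phi_decay P
  have s1 := odd_summable h (show 0 < ε / 2 by positivity)
  have s2 := odd_summable h h0
  have e1 := odd_split h (show 0 < ε / 2 by positivity)
  have e2 := odd_split h h0
  have e3 := (s1.sub s2).tsum_eq_zero_add
  rw [s1.tsum_sub s2, e1, e2] at e3
  simp only [CharP.cast_eq_zero, mul_zero, zero_add, one_mul] at e3
  rw [show 2 * (ε / 2) = ε by ring] at e3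
  simp only [DD]
  linarith

lemma total_sum (P : Polynomial ℝ) {ε : ℝ} (h0 : 0 < ε) (N : ℕ) :
    ∑' p : ℕ × ℕ, (if p.1 % 2 = N % 2 then gP P (upsHK p.1 p.2 * ε) else 0) =
      if N % 2 = 1 then DD P (ε / 2) - 2 * DD P ε + DD P (2 * ε) - Phi P (ε / 2) + Phi P ε
      else DD P ε - DD P (2 * ε) := by
  have hs : Summable (fun p : ℕ × ℕ => if p.1 % 2 = N % 2 then gP P (upsHK p.1 p.2 * ε) else 0) := by
    refine Summable.of_norm_bounded (gP_prod_summable P h0) fun p => ?_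
    split_ifs
    · exact le_rfl
    · simp
  have hc := hs.prod
  rw [hs.tsum_prod]
  set F : ℕ → ℝ := fun a => ∑' k : ℕ, (if a % 2 = N % 2 then gP P (upsHK a k * ε) else 0) with hF
  have hc2 : Summable F := hc
  have i1 : Function.Injective (fun a : ℕ => 2 * a) := fun a b h => by
    simp only at h; omega
  have i2 : Function.Injective (fun a : ℕ => 2 * a + 1) := fun a b h => by
    simp only at h; omega
  have key : ∑' a, F a = ∑' a, F (2 * a) + ∑' a, F (2 * a + 1) :=
    (tsum_even_add_odd (hc2.comp_injective i1) (hc2.comp_injective i2)).symm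
  change ∑' a, F a = _
  rw [key]
  rcases Nat.mod_two_eq_zero_or_one N with hN | hN
  · have f1 : ∀ a, F (2 * a) = Phi P (((a : ℝ) + 1) * ε) - Phi P (((a : ℝ) + 1) * (2 * ε)) := by
      intro a
      rw [← inner_even P h0 a, hF]
      refine tsum_congr fun k => ?_
      rw [if_pos (by omega)]
    have f2 : ∀ a, F (2 * a + 1) = 0 := by
      intro a
      rw [← tsum_zero (α := ℝ) (β := ℕ), hF]
      refine tsum_congr fun k => ?_
      rw [if_neg (by omega)]
    rw [tsum_congr f1, tsum_congr f2, tsum_zero, add_zero, outer_even P h0, if_neg (by omega)]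
  · have f1 : ∀ a, F (2 * a + 1) = Phi P ((2 * ((a + 1 : ℕ) : ℝ) + 1) * (ε / 2)) -
        Phi P ((2 * ((a + 1 : ℕ) : ℝ) + 1) * ε) := by
      intro a
      rw [← inner_odd P h0 a, hF]
      refine tsum_congr fun k => ?_
      rw [if_pos (by omega)]
    have f2 : ∀ a, F (2 * a) = 0 := by
      intro a
      rw [← tsum_zero (α := ℝ) (β := ℕ), hF]
      refine tsum_congr fun k => ?_
      rw [if_neg (by omega)]
    rw [tsum_congr f1, tsum_congr f2, tsum_zero, zero_add, outer_odd P h0, if_pos hN]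

lemma summand_eq (j N : ℕ) (hN : 0 < N) (ε : ℝ) (hε : ε ^ 2 * ((N : ℝ) / 2) = 1) (p : ℕ × ℕ) :
    upsSummandJ j N p = ((N : ℝ) / 2) ^ j *
      (if p.1 % 2 = N % 2 then gP (PJ j) (upsHK p.1 p.2 * ε) else 0) := by
  unfold upsSummandJ
  have hm : (0 : ℝ) < (N : ℝ) / 2 := by positivity
  split_ifs
  · have e : (upsHK p.1 p.2 * ε) ^ 2 = upsHK p.1 p.2 ^ 2 / ((N : ℝ) / 2) := by
      rw [mul_pow, eq_div_iff hm.ne', mul_assoc, hε, mul_one]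
    have e2 : (upsHK p.1 p.2 * ε) ^ (2 * j) = upsHK p.1 p.2 ^ (2 * j) / ((N : ℝ) / 2) ^ j := by
      rw [pow_mul, e, div_pow, ← pow_mul]
    rw [gP, PJ_eval, e2, e, sub_div, div_self hm.ne']
    have : ((N : ℝ) / 2) ^ j ≠ 0 := by positivity
    field_simp
  · simp

theorem ups_harmonic_sum_asymptotics_j (j : ℕ) (hj : 1 ≤ j) (K : ℝ) (hK : 0 < K) :
    ∃ C > (0 : ℝ), ∃ N₀ : ℕ, ∀ N : ℕ, N₀ ≤ N →
      Summable (fun p : ℕ × ℕ => |upsSummandJ j N p|) ∧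
      |(∑' p : ℕ × ℕ, upsSummandJ j N p) -
          (Real.log ((N : ℝ) / 2) / 2 + 2 * Real.eulerMascheroniConstant + Real.log 2 +
              digammaHalf j / 2 + 1 / (2 * (j : ℝ)) +
              (if N % 2 = 1 then 2 * Real.log 2 - 2 else 0)) *
            ((j : ℝ) / 2) * Real.Gamma ((j : ℝ) + 1 / 2) *
            ((N : ℝ) / 2) ^ ((j : ℝ) + 1 / 2)| ≤
        C * ((N : ℝ) / 2) ^ (-K) := by
  obtain ⟨K0, hK0⟩ := exists_nat_ge (2 * K + 2 * j + 1)
  have hK1 : 1 ≤ K0 := by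
    have : (1 : ℝ) ≤ K0 := by
      have : (0 : ℝ) ≤ j := by positivity
      linarith
    exact_mod_cast this
  obtain ⟨hPhi, hDD⟩ := PJ_asymp j hj K0 hK1 _ _ rfl rfl
  obtain ⟨C1, h1⟩ := core_even _ K0 _ _ hDD
  obtain ⟨C2, h2⟩ := core_odd _ K0 _ _ hPhi hDD
  refine ⟨|C1| + |C2| + 1, by positivity, 8, fun N hN => ?_⟩
  have hNr : (8 : ℝ) ≤ N := by exact_mod_cast hN
  set m : ℝ := (N : ℝ) / 2 with hm
  have hm4 : 4 ≤ m := by rw [hm]; linarith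
  have hm0 : 0 < m := by linarith
  set ε : ℝ := m ^ (-(1 / 2) : ℝ) with hε
  have h0 : 0 < ε := by positivity
  have hε2 : ε ^ 2 * m = 1 := by
    rw [hε, ← Real.rpow_natCast, ← Real.rpow_mul hm0.le]
    norm_num
    rw [Real.rpow_neg_one]
    exact inv_mul_cancel₀ hm0.ne'
  have hεh : ε ≤ 1 / 2 := by
    by_contra hcon
    push Not at hcon
    nlinarith
  have hlog : Real.log ε = -(1 / 2) * Real.log m := by rw [hε, Real.log_rpow hm0]
  have hse := fun p => summand_eq j N (by omega) ε hε2 p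
  have hpow : m ^ j * (1 / ε) = m ^ ((j : ℝ) + 1 / 2) := by
    rw [hε, one_div, ← Real.rpow_neg hm0.le, neg_neg, Real.rpow_add hm0, Real.rpow_natCast]
  have hfin : m ^ j * (ε ^ K0 / ε) ≤ m ^ (-K) := by
    have : m ^ j * (ε ^ K0 / ε) = m ^ ((j : ℝ) + 1 / 2 + -(1 / 2) * K0) := by
      rw [Real.rpow_add hm0, ← hpow, Real.rpow_mul hm0.le, Real.rpow_natCast]
      ring
    rw [this]
    refine Real.rpow_le_rpow_of_exponent_le (by linarith) ?_
    linarith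
  have gen : ∀ C X Y : ℝ, |C| ≤ |C1| + |C2| + 1 → |X - 1 / ε * Y| ≤ C * ε ^ K0 / ε →
      |m ^ j * X - Y * m ^ ((j : ℝ) + 1 / 2)| ≤ (|C1| + |C2| + 1) * m ^ (-K) := by
    intro C X Y hC hX
    have e : m ^ j * X - Y * m ^ ((j : ℝ) + 1 / 2) = m ^ j * (X - 1 / ε * Y) := by
      rw [← hpow]; ring
    rw [e, abs_mul, abs_of_pos (by positivity)]
    calc m ^ j * |X - 1 / ε * Y| ≤ m ^ j * (C * ε ^ K0 / ε) := by gcongr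
      _ = C * (m ^ j * (ε ^ K0 / ε)) := by ring
      _ ≤ (|C1| + |C2| + 1) * (m ^ j * (ε ^ K0 / ε)) := by
        gcongr
        exact (le_abs_self C).trans hC
      _ ≤ _ := by gcongr
  constructor
  · refine Summable.of_nonneg_of_le (fun p => abs_nonneg _) (fun p => ?_)
      ((gP_prod_summable (PJ j) h0).mul_left (m ^ j))
    rw [hse p, abs_mul, abs_of_pos (by positivity)]
    refine mul_le_mul_of_nonneg_left ?_ (by positivity)
    split_ifs
    · exact le_rfl
    · simp
  · rw [tsum_congr hse, tsum_mul_left, total_sum (PJ j) h0 N]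
    split_ifs with hodd
    · have := gen C2 _ _ (by linarith [abs_nonneg C1]) (h2 ε h0 hεh)
      convert this using 3
      rw [hlog]
      ring
    · have := gen C1 _ _ (by linarith [abs_nonneg C2]) (h1 ε h0 hεh)
      convert this using 3
      rw [hlog]
      ring
end

section
/- Fix integers j ≥ 0, r ≥ 1 and K > 0. For a positive integer N set m = N/2 and υ_{h,k} = (h+2)(2k+1)/2. Then, as N → ∞, Σ_{h,k ≥ 0, h ≡ N (mod 2)} ((2υ_{h,k}² − m)/m) · υ_{h,k}^{2j} · (h+2)^r · exp(−υ_{h,k}²/m) = j Γ(j+1/2) κ_N(1−r) m^{j+1/2} + (1/2)(j + r/2) Γ(j + (r+1)/2) (2^{r+1} − 1) ζ(r+1) m^{j+(r+1)/2} + O(m^{−K}), where κ_N(1−r) = 2^{r−1} ζ(1−r) if N is even and κ_N(1−r) = (1 − 2^{r−1}) ζ(1−r) − 1 if N is odd; here ζ denotes the analytically continued Riemann zeta function (with ζ(0) = −1/2 for the case r = 1) and Γ the Gamma function. -/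
open Real

/-- Summand of the harmonic sum (4.2) with weights `υ_{h,k}^{2j} (h+2)^r`: for pairs `(h,k)`
with `h ≡ N (mod 2)`, `((2υ_{h,k}² − m)/m) υ_{h,k}^{2j} (h+2)^r exp(−υ_{h,k}²/m)`, `m = N/2`. -/
noncomputable def upsSummandJR (j r N : ℕ) (p : ℕ × ℕ) : ℝ :=
  if p.1 % 2 = N % 2 then
    (2 * upsHK p.1 p.2 ^ 2 - (N : ℝ) / 2) / ((N : ℝ) / 2) * upsHK p.1 p.2 ^ (2 * j) *
      ((p.1 : ℝ) + 2) ^ r * Real.exp (-(upsHK p.1 p.2 ^ 2 / ((N : ℝ) / 2)))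
  else 0

/-- `κ_N(1−r)`: equal to `2^{r−1} ζ(1−r)` for even `N` and `(1−2^{r−1}) ζ(1−r) − 1` for odd `N`,
where `ζ` is the analytically continued Riemann zeta function. -/
noncomputable def kappaVal (N r : ℕ) : ℝ :=
  if N % 2 = 0 then 2 ^ ((r : ℝ) - 1) * (riemannZeta (1 - (r : ℂ))).re
  else (1 - 2 ^ ((r : ℝ) - 1)) * (riemannZeta (1 - (r : ℂ))).re - 1



namespace UpsEM

open Set Filter Topology MeasureTheory

def DerivSeq (g : ℕ → ℝ → ℝ) : Prop :=
  (∀ k x, HasDerivAt (g k) (g (k+1) x) x) ∧ ∀ k, ∃ C : ℝ, ∀ x : ℝ, 1 ≤ x → |g k x| ≤ C / x^2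

lemma DerivSeq.cont {g : ℕ → ℝ → ℝ} (hg : DerivSeq g) (k : ℕ) : Continuous (g k) :=
  continuous_iff_continuousAt.2 fun x => (hg.1 k x).continuousAt

lemma DerivSeq.bound {g : ℕ → ℝ → ℝ} (hg : DerivSeq g) (k : ℕ) :
    ∃ C : ℝ, 0 < C ∧ ∀ x : ℝ, 0 ≤ x → |g k x| ≤ C * (1 + x^2)⁻¹ := by
  obtain ⟨C1, h1⟩ := hg.2 k
  obtain ⟨C2, h2⟩ := (isCompact_Icc (a := (0:ℝ)) (b := 1)).exists_bound_of_continuousOn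
    (hg.cont k).continuousOn
  refine ⟨2 * (|C1| + |C2| + 1), by positivity, fun x hx => ?_⟩
  have hp : 0 < 1 + x^2 := by positivity
  rw [← div_eq_mul_inv, le_div_iff₀ hp]
  rcases le_total x 1 with h | h
  · have := h2 x ⟨hx, h⟩
    rw [Real.norm_eq_abs] at this
    have h3 : x^2 ≤ 1 := by nlinarith
    have h4 := le_abs_self C2
    have h5 := abs_nonneg C1
    have h6 := abs_nonneg (g k x)
    nlinarith
  · have := h1 x h
    rw [le_div_iff₀ (by positivity)] at this
    have h3 : 1 ≤ x^2 := by nlinarith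
    have h4 := le_abs_self C1
    have h5 := abs_nonneg C2
    have h6 := abs_nonneg (g k x)
    nlinarith

lemma DerivSeq.integrableOn {g : ℕ → ℝ → ℝ} (hg : DerivSeq g) (k : ℕ) :
    IntegrableOn (g k) (Ioi 0) := by
  obtain ⟨C, hC, h⟩ := hg.bound k
  refine Integrable.mono' ((integrable_inv_one_add_sq.integrableOn (s := Ioi 0)).const_mul C)
    (hg.cont k).aestronglyMeasurable ?_
  filter_upwards [ae_restrict_mem measurableSet_Ioi] with x hx
  exact h x (le_of_lt hx)

lemma DerivSeq.tendsto {g : ℕ → ℝ → ℝ} (hg : DerivSeq g) (k : ℕ) :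
    Tendsto (g k) atTop (𝓝 0) := by
  obtain ⟨C, h⟩ := hg.2 k
  have h2 : Tendsto (fun x : ℝ => C / x^2) atTop (𝓝 0) :=
    tendsto_const_nhds.div_atTop (tendsto_pow_atTop (by norm_num))
  refine squeeze_zero_norm' ?_ h2
  filter_upwards [eventually_ge_atTop 1] with x hx using h x hx

lemma DerivSeq.summable {g : ℕ → ℝ → ℝ} (hg : DerivSeq g) (k : ℕ) {t : ℝ} (ht : 0 < t) :
    Summable (fun a : ℕ => g k (((a:ℝ)+1) * t)) := by
  obtain ⟨C, hC, h⟩ := hg.bound k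
  have hs : Summable (fun a : ℕ => C / t^2 * (1 / ((a:ℝ)+1)^2)) := by
    apply Summable.mul_left
    have := (summable_nat_add_iff 1).2 (Real.summable_one_div_nat_pow.2 (by norm_num : 1 < 2))
    simpa using this
  refine Summable.of_norm_bounded hs fun a => ?_
  refine (h _ (by positivity)).trans ?_
  rw [← div_eq_mul_inv, div_mul_div_comm, mul_one, ← mul_pow, mul_comm t]
  apply div_le_div_of_nonneg_left hC.le (by positivity)
  linarith

lemma em_step (g : ℕ → ℝ → ℝ) (hg : ∀ k x, HasDerivAt (g k) (g (k+1) x) x) (k : ℕ) (a : ℝ) :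
    ∫ x in (0:ℝ)..1, bernoulliFun k x / (k.factorial : ℝ) * g k (a + x) =
      (bernoulliFun (k+1) 1 * g k (a+1) - bernoulliFun (k+1) 0 * g k a) / ((k+1).factorial : ℝ)
      - ∫ x in (0:ℝ)..1, bernoulliFun (k+1) x / ((k+1).factorial : ℝ) * g (k+1) (a + x) := by
  have hc : ∀ k, Continuous (g k) := fun k =>
    continuous_iff_continuousAt.2 fun x => (hg k x).continuousAt
  have hv : ∀ x ∈ uIcc (0:ℝ) 1, HasDerivAt (fun x => bernoulliFun (k+1) x / ((k+1).factorial : ℝ))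
      (bernoulliFun k x / (k.factorial : ℝ)) x := by
    intro x _
    have := (hasDerivAt_bernoulliFun (k+1) x).div_const ((k+1).factorial : ℝ)
    refine this.congr_deriv ?_
    have : (k.factorial : ℝ) ≠ 0 := by positivity
    have : (k : ℝ) + 1 ≠ 0 := by positivity
    rw [Nat.factorial_succ]
    push_cast
    field_simp
  have hu : ∀ x ∈ uIcc (0:ℝ) 1, HasDerivAt (fun x => g k (a + x)) (g (k+1) (a+x)) x := by
    intro x _
    exact (hg k (a+x)).comp_const_add a x
  have := intervalIntegral.integral_mul_deriv_eq_deriv_mul hu hv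
    (((hc (k+1)).comp (by fun_prop : Continuous fun x => a + x)).intervalIntegrable _ _)
    (((continuous_bernoulliFun k).div_const _).intervalIntegrable _ _)
  simp only [mul_comm (g _ _)] at this
  rw [this]
  simp
  ring

lemma em_interval (g : ℕ → ℝ → ℝ) (hg : ∀ k x, HasDerivAt (g k) (g (k+1) x) x) (a : ℝ) (n : ℕ) :
    g 0 (a+1) = (∫ x in a..(a+1), g 0 x)
      - ∑ k ∈ Finset.range (n+1), (-1:ℝ)^k * (bernoulli (k+1) : ℝ) / ((k+1).factorial : ℝ)
          * (g k (a+1) - g k a)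
      + (-1)^n * ∫ x in (0:ℝ)..1, bernoulliFun (n+1) x / ((n+1).factorial : ℝ) * g (n+1) (a + x) := by
  induction n with
  | zero =>
    have h := em_step g hg 0 a
    simp [bernoulliFun_one] at h
    simp [bernoulliFun_one]
    rw [show (a:ℝ) + 1 = 1 + a by ring] at *
    linarith
  | succ n ih =>
    rw [ih, em_step g hg (n+1) a, bernoulliFun_endpoints_eq_of_ne_one (by omega),
      Finset.sum_range_succ _ (n+1), bernoulliFun_eval_zero]
    ring

lemma em_bern_bound (n : ℕ) : ∃ M : ℝ, 0 < M ∧ ∀ x ∈ Icc (0:ℝ) 1,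
    |bernoulliFun n x / (n.factorial : ℝ)| ≤ M := by
  obtain ⟨C2, h2⟩ := (isCompact_Icc (a := (0:ℝ)) (b := 1)).exists_bound_of_continuousOn
    ((continuous_bernoulliFun n).div_const (n.factorial : ℝ)).continuousOn
  exact ⟨|C2| + 1, by positivity, fun x hx => by
    have := h2 x hx
    rw [Real.norm_eq_abs] at this
    linarith [le_abs_self C2]⟩

lemma DerivSeq.scale {g : ℕ → ℝ → ℝ} (hg : DerivSeq g) (t : ℝ) (k : ℕ) (x : ℝ) :
    HasDerivAt (fun x => t^k * g k (x*t)) (t^(k+1) * g (k+1) (x*t)) x := by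
  have := ((hg.1 k (x*t)).comp x ((hasDerivAt_id x).mul_const t)).const_mul (t^k)
  refine this.congr_deriv ?_
  ring

/-- Euler–Maclaurin for sums over positive multiples of `t`. -/
theorem euler_mac {g : ℕ → ℝ → ℝ} (hg : DerivSeq g) (n : ℕ) :
    ∃ C : ℝ, 0 < C ∧ ∀ t : ℝ, 0 < t →
      |(∑' a : ℕ, g 0 (((a:ℝ)+1) * t)) - (t⁻¹ * (∫ x in Ioi (0:ℝ), g 0 x) +
        ∑ k ∈ Finset.range (n+1), (-1:ℝ)^k * (bernoulli (k+1) : ℝ) / ((k+1).factorial : ℝ)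
          * (t^k * g k 0))| ≤ C * t^n := by
  obtain ⟨M, hM, hB⟩ := em_bern_bound (n+1)
  set I := ∫ x in Ioi (0:ℝ), |g (n+1) x| with hI
  have hI0 : 0 ≤ I := integral_nonneg fun x => abs_nonneg _
  refine ⟨M * I + 1, by positivity, fun t ht => ?_⟩
  set b : ℕ → ℝ := fun k => (-1:ℝ)^k * (bernoulli (k+1) : ℝ) / ((k+1).factorial : ℝ) with hb
  set G : ℕ → ℝ → ℝ := fun k x => t^k * g k (x*t) with hG
  have hGd : ∀ k x, HasDerivAt (G k) (G (k+1) x) x := fun k x => hg.scale t k x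
  have hGc : ∀ k, Continuous (G k) := fun k =>
    continuous_iff_continuousAt.2 fun x => (hGd k x).continuousAt
  set J : ℕ → ℝ := fun a => ∫ x in (0:ℝ)..1, bernoulliFun (n+1) x / ((n+1).factorial : ℝ)
    * G (n+1) (a + x) with hJ
  have hsum : ∀ A : ℕ, ∑ a ∈ Finset.range A, G 0 ((a:ℝ)+1) = (∫ x in (0:ℝ)..A, G 0 x)
      - ∑ k ∈ Finset.range (n+1), b k * (G k A - G k 0)
      + (-1)^n * ∑ a ∈ Finset.range A, J a := by
    intro A
    induction A with
    | zero => simp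
    | succ A ih =>
      rw [Finset.sum_range_succ, ih, em_interval G hGd A n, Finset.sum_range_succ _ A]
      have h1 : (∫ x in (0:ℝ)..((A+1:ℕ):ℝ), G 0 x) = (∫ x in (0:ℝ)..A, G 0 x)
          + ∫ x in (A:ℝ)..(A+1), G 0 x := by
        push_cast
        rw [intervalIntegral.integral_add_adjacent_intervals] <;>
          exact (hGc 0).intervalIntegrable _ _
      have h2 : ∑ k ∈ Finset.range (n+1), b k * (G k ((A+1:ℕ):ℝ) - G k 0) =
          ∑ k ∈ Finset.range (n+1), b k * (G k A - G k 0) +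
          ∑ k ∈ Finset.range (n+1), b k * (G k (A+1) - G k A) := by
        rw [← Finset.sum_add_distrib]
        refine Finset.sum_congr rfl fun k _ => ?_
        push_cast; ring
      rw [h1, h2]
      ring
  have hJb : ∀ a : ℕ, |J a| ≤ M * ∫ x in (a:ℝ)..(a+1), |G (n+1) x| := by
    intro a
    have e : (∫ x in (a:ℝ)..(a+1), |G (n+1) x|) = ∫ x in (0:ℝ)..1, |G (n+1) (a+x)| := by
      rw [intervalIntegral.integral_comp_add_left (fun x => |G (n+1) x|)]
      simp
    rw [e, ← intervalIntegral.integral_const_mul]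
    rw [← Real.norm_eq_abs]
    refine intervalIntegral.norm_integral_le_of_norm_le zero_le_one ?_ ?_
    · refine Eventually.of_forall fun x hx => ?_
      rw [norm_mul]
      gcongr
      · exact hB x ⟨hx.1.le, hx.2⟩
      · rw [Real.norm_eq_abs]
    · have := hGc (n+1)
      exact Continuous.intervalIntegrable (by fun_prop) _ _
  have hGi : ∀ k, IntegrableOn (G k) (Ioi 0) := by
    intro k
    have := (integrableOn_Ioi_comp_mul_right_iff (g k) 0 ht).2 (by simpa using hg.integrableOn k)
    exact this.const_mul (t^k)
  have hGint : ∫ x in Ioi (0:ℝ), |G (n+1) x| = t^n * I := by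
    have := integral_comp_mul_right_Ioi (fun x => |g (n+1) x|) 0 ht
    simp only [hG, abs_mul, abs_pow, abs_of_pos ht]
    rw [integral_const_mul, this]
    simp [hI]
    field_simp
    ring
  have hGint0 : ∫ x in Ioi (0:ℝ), G 0 x = t⁻¹ * ∫ x in Ioi (0:ℝ), g 0 x := by
    have := integral_comp_mul_right_Ioi (fun x => g 0 x) 0 ht
    simp only [hG, pow_zero, one_mul]
    rw [this]; simp
  have hJs : ∀ A : ℕ, |∑ a ∈ Finset.range A, J a| ≤ M * (t^n * I) := by
    intro A
    calc |∑ a ∈ Finset.range A, J a| ≤ ∑ a ∈ Finset.range A, M * ∫ x in (a:ℝ)..(a+1), |G (n+1) x| :=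
          (Finset.abs_sum_le_sum_abs _ _).trans (Finset.sum_le_sum fun a _ => hJb a)
      _ = M * ∫ x in (0:ℝ)..A, |G (n+1) x| := by
          rw [← Finset.mul_sum]
          congr 1
          have := intervalIntegral.sum_integral_adjacent_intervals (f := fun x => |G (n+1) x|)
            (μ := volume) (a := fun i : ℕ => (i:ℝ)) (n := A)
            (fun k _ => ((hGc (n+1)).abs).intervalIntegrable _ _)
          simpa using this
      _ ≤ M * (t^n * I) := by
          gcongr
          rw [← hGint, intervalIntegral.integral_of_le (by positivity)]
          apply setIntegral_mono_set (hGi (n+1)).abs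
          · exact Eventually.of_forall fun x => abs_nonneg _
          · exact LE.le.eventuallyLE Ioc_subset_Ioi_self
  have hTsum : Tendsto (fun A : ℕ => ∑ a ∈ Finset.range A, G 0 ((a:ℝ)+1)) atTop
      (𝓝 (∑' a : ℕ, g 0 (((a:ℝ)+1) * t))) := by
    have := (hg.summable 0 ht).hasSum.tendsto_sum_nat
    simpa [hG] using this
  have hTint : Tendsto (fun A : ℕ => ∫ x in (0:ℝ)..A, G 0 x) atTop
      (𝓝 (t⁻¹ * ∫ x in Ioi (0:ℝ), g 0 x)) := by
    rw [← hGint0]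
    exact intervalIntegral_tendsto_integral_Ioi 0 (hGi 0) tendsto_natCast_atTop_atTop
  have hTG : ∀ k, Tendsto (fun A : ℕ => G k A) atTop (𝓝 0) := by
    intro k
    have : Tendsto (fun A : ℕ => (A:ℝ) * t) atTop atTop :=
      tendsto_natCast_atTop_atTop.atTop_mul_const ht
    simpa [hG] using ((hg.tendsto k).comp this).const_mul (t^k)
  have hTs : Tendsto (fun A : ℕ => ∑ k ∈ Finset.range (n+1), b k * (G k A - G k 0)) atTop
      (𝓝 (∑ k ∈ Finset.range (n+1), b k * (0 - G k 0))) :=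
    tendsto_finsetSum _ fun k _ => ((hTG k).sub_const _).const_mul _
  have hT := ((hTsum.sub hTint).add hTs).abs
  have hle : ∀ A : ℕ, |∑ a ∈ Finset.range A, G 0 ((a:ℝ)+1) - (∫ x in (0:ℝ)..A, G 0 x)
      + ∑ k ∈ Finset.range (n+1), b k * (G k A - G k 0)| ≤ M * (t^n * I) := by
    intro A
    rw [hsum A]
    refine le_trans (le_of_eq ?_) (hJs A)
    rw [show ∀ x y z : ℝ, x - y + z - x + y = z by intros; ring, abs_mul]
    simp
  have := le_of_tendsto' hT hle
  have e : ∑ k ∈ Finset.range (n+1), b k * (0 - G k 0) = - ∑ k ∈ Finset.range (n+1),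
      b k * (t^k * g k 0) := by
    simp [hG]
  rw [e] at this
  rw [show ∀ x y z : ℝ, x - (y + z) = x - y + - z by intros; ring]
  refine this.trans ?_
  have : 0 < t^n := by positivity
  nlinarith

end UpsEM

namespace UpsEM

open Set Filter Topology MeasureTheory

open Polynomial

noncomputable def Fp (p : ℝ[X]) (x : ℝ) : ℝ := p.eval x * Real.exp (-x^2)

noncomputable def Dp (p : ℝ[X]) : ℝ[X] := derivative p - 2 * X * p

noncomputable def Lp (s : ℝ) (p : ℝ[X]) : ℝ[X] := C s * p + X * Dp p

noncomputable def Phi (p : ℝ[X]) (t : ℝ) : ℝ := ∑' k : ℕ, Fp p ((2 * (k:ℝ) + 1) * t)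

noncomputable def cP (p : ℝ[X]) : ℝ := 1 / 2 * ∫ x in Ioi (0:ℝ), Fp p x

lemma hasDerivAt_Fp (p : ℝ[X]) (x : ℝ) : HasDerivAt (Fp p) (Fp (Dp p) x) x := by
  have h1 := p.hasDerivAt x
  have h2 : HasDerivAt (fun x : ℝ => Real.exp (-x^2)) (Real.exp (-x^2) * (-(2 * x))) x := by
    have : HasDerivAt (fun x : ℝ => -x^2) (-(2*x)) x :=
      (hasDerivAt_pow 2 x).neg.congr_deriv (by simp)
    exact this.exp
  refine (h1.mul h2).congr_deriv ?_
  simp [Fp, Dp]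
  ring

lemma Fp_Lp (s : ℝ) (p : ℝ[X]) (x : ℝ) : Fp (Lp s p) x = s * Fp p x + x * Fp (Dp p) x := by
  simp [Fp, Lp]; ring

lemma pow_exp_bound (N : ℕ) (x : ℝ) :
    x^N * Real.exp (-x^2) ≤ 1 + (N.factorial : ℝ) := by
  have h := Real.pow_div_factorial_le_exp (x^2) (by positivity) N
  have hf : (0:ℝ) < N.factorial := by positivity
  rw [div_le_iff₀ hf] at h
  have he : Real.exp (-x^2) * Real.exp (x^2) = 1 := by rw [← Real.exp_add]; simp
  have he0 := Real.exp_pos (-x^2)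
  have he1 : Real.exp (-x^2) ≤ 1 := Real.exp_le_one_iff.2 (by nlinarith)
  have h2 : x^N ≤ 1 + (x^2)^N := by
    rw [← pow_mul, mul_comm, pow_mul]; nlinarith [sq_nonneg (x^N - 1)]
  calc x^N * Real.exp (-x^2) ≤ (1 + (x^2)^N) * Real.exp (-x^2) := by gcongr
    _ ≤ (1 + Real.exp (x^2) * N.factorial) * Real.exp (-x^2) := by gcongr
    _ = Real.exp (-x^2) + N.factorial * (Real.exp (-x^2) * Real.exp (x^2)) := by ring
    _ ≤ _ := by rw [he]; linarith

lemma Fp_bound (p : ℝ[X]) (M : ℕ) : ∃ C : ℝ, 0 < C ∧ ∀ x : ℝ, 0 < x → |Fp p x| ≤ C / x^M := by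
  induction p using Polynomial.induction_on' with
  | add p q hp hq =>
    obtain ⟨C1, h1, H1⟩ := hp
    obtain ⟨C2, h2, H2⟩ := hq
    refine ⟨C1 + C2, by positivity, fun x hx => ?_⟩
    have : Fp (p+q) x = Fp p x + Fp q x := by simp [Fp]; ring
    rw [this, add_div]
    exact (abs_add_le _ _).trans (add_le_add (H1 x hx) (H2 x hx))
  | monomial n a =>
    refine ⟨|a| * (1 + ((n+M).factorial : ℝ)) + 1, by positivity, fun x hx => ?_⟩
    rw [le_div_iff₀ (by positivity)]
    have := pow_exp_bound (n+M) x
    have e : |Fp (monomial n a) x| * x^M = |a| * (x^(n+M) * Real.exp (-x^2)) := by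
      simp [Fp, abs_mul, abs_of_pos hx, pow_add]; ring
    rw [e]
    nlinarith [abs_nonneg a]

lemma Fp_derivSeq (p : ℝ[X]) : DerivSeq (fun k => Fp (Dp^[k] p)) := by
  constructor
  · intro k x
    simp only [Function.iterate_succ_apply']
    exact hasDerivAt_Fp _ x
  · intro k
    obtain ⟨C, _, h⟩ := Fp_bound (Dp^[k] p) 2
    exact ⟨C, fun x hx => h x (by linarith)⟩

lemma Fp_continuous (p : ℝ[X]) : Continuous (Fp p) := (Fp_derivSeq p).cont 0

lemma Fp_integrableOn (p : ℝ[X]) : IntegrableOn (Fp p) (Ioi 0) := (Fp_derivSeq p).integrableOn 0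

lemma Dp_comp (p : ℝ[X]) : (Dp p).comp (-X) = - Dp (p.comp (-X)) := by
  simp [Dp, derivative_comp]
  ring

lemma Dp_iter_comp (p : ℝ[X]) (hp : p.comp (-X) = p) (k : ℕ) :
    (Dp^[k] p).comp (-X) = (-1)^k * Dp^[k] p := by
  induction k with
  | zero => simpa using hp
  | succ k ih =>
    rw [Function.iterate_succ_apply', Dp_comp, ih]
    rcases Nat.even_or_odd k with h | h
    · simp [h.neg_one_pow, h.add_one.neg_one_pow]
    · simp [h.neg_one_pow, h.add_one.neg_one_pow, Dp]
      ring

lemma Lp_comp (s : ℝ) (p : ℝ[X]) (hp : p.comp (-X) = p) : (Lp s p).comp (-X) = Lp s p := by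
  simp [Lp, hp, Dp_comp]

lemma Dp_iter_odd (p : ℝ[X]) (hp : p.comp (-X) = p) (k : ℕ) (hk : Odd k) :
    Fp (Dp^[k] p) 0 = 0 := by
  have := congrArg (Polynomial.eval 0) (Dp_iter_comp p hp k)
  simp [hk.neg_one_pow] at this
  simp [Fp]
  linarith

lemma Fp_summable (p : ℝ[X]) {t : ℝ} (ht : 0 < t) :
    Summable (fun k : ℕ => Fp p ((2 * (k:ℝ) + 1) * t)) := by
  have h := (Fp_derivSeq p).summable 0 ht
  have := h.comp_injective (i := fun k : ℕ => 2 * k) (fun a b h => by simpa using h)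
  simpa [Function.comp_def] using this

lemma Phi_eq (p : ℝ[X]) {t : ℝ} (ht : 0 < t) : Phi p t =
    (∑' a : ℕ, Fp p (((a:ℝ)+1) * t)) - ∑' a : ℕ, Fp p (((a:ℝ)+1) * (2*t)) := by
  have h : Summable (fun a : ℕ => Fp p (((a:ℝ)+1) * t)) := (Fp_derivSeq p).summable 0 ht
  set f : ℕ → ℝ := fun a : ℕ => Fp p (((a:ℝ)+1) * t) with hf
  have h1 : Summable fun k : ℕ => f (2 * k) := h.comp_injective (fun a b h => by simpa using h)
  have h2 : Summable fun k : ℕ => f (2 * k + 1) := h.comp_injective (fun a b h => by simpa using h)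
  have := tsum_even_add_odd h1 h2
  rw [← this, Phi]
  simp only [hf]
  have e : ∀ a : ℕ, Fp p ((((2*a+1:ℕ):ℝ)+1) * t) = Fp p (((a:ℝ)+1) * (2*t)) := by
    intro a; congr 1; push_cast; ring
  simp only [e]
  push_cast
  ring

lemma Phi_flat (p : ℝ[X]) (hp : p.comp (-X) = p) (n : ℕ) :
    ∃ C : ℝ, 0 < C ∧ ∀ t : ℝ, 0 < t → |Phi p t - cP p / t| ≤ C * t^n := by
  obtain ⟨C, hC, h⟩ := euler_mac (Fp_derivSeq p) n
  refine ⟨C + C * 2^n, by positivity, fun t ht => ?_⟩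
  have h1 := h t ht
  have h2 := h (2*t) (by positivity)
  have e : ∀ k, (-1:ℝ)^k * (bernoulli (k+1) : ℝ) / ((k+1).factorial : ℝ)
          * (t^k * Fp (Dp^[k] p) 0) = (-1:ℝ)^k * (bernoulli (k+1) : ℝ) / ((k+1).factorial : ℝ)
          * ((2*t)^k * Fp (Dp^[k] p) 0) := by
    intro k
    rcases Nat.even_or_odd k with hk | hk
    · rcases Nat.eq_zero_or_pos k with rfl | h0
      · simp
      · have : _root_.bernoulli (k+1) = 0 := bernoulli_eq_zero_of_odd hk.add_one (by omega)
        simp [this]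
    · simp [Dp_iter_odd p hp k hk]
  simp only [← e] at h2
  simp only [Function.iterate_zero, id] at h1 h2
  rw [Phi_eq p ht]
  have e2 : cP p / t = t⁻¹ * (∫ x in Ioi (0:ℝ), Fp p x) - (2*t)⁻¹ * (∫ x in Ioi (0:ℝ), Fp p x) := by
    rw [cP]; field_simp; ring
  rw [e2]
  rw [mul_pow] at h2
  have := (abs_sub _ _).trans (add_le_add h1 h2)
  refine le_trans (le_of_eq ?_) (this.trans (le_of_eq (by ring)))
  congr 1
  ring

lemma Phi_decay (p : ℝ[X]) (M : ℕ) (hM : 2 ≤ M) :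
    ∃ C : ℝ, 0 < C ∧ ∀ t : ℝ, 0 < t → |Phi p t| ≤ C / t^M := by
  obtain ⟨C, hC, h⟩ := Fp_bound p M
  have hs : Summable (fun k : ℕ => 1 / ((k:ℝ)+1)^M) := by
    have := (summable_nat_add_iff 1).2 (Real.summable_one_div_nat_pow.2 (by omega : 1 < M))
    simpa using this
  refine ⟨C * (∑' k : ℕ, 1 / ((k:ℝ)+1)^M) + 1, by positivity, fun t ht => ?_⟩
  have hs2 := hs.mul_left (C / t^M)
  have : ‖Phi p t‖ ≤ ∑' k : ℕ, C / t^M * (1 / ((k:ℝ)+1)^M) := by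
    refine tsum_of_norm_bounded hs2.hasSum fun k => ?_
    refine (h _ (by positivity)).trans ?_
    rw [div_mul_div_comm, mul_one, mul_pow, mul_comm (t^M)]
    gcongr
    have : (0:ℝ) ≤ k := by positivity
    linarith
  rw [tsum_mul_left] at this
  rw [Real.norm_eq_abs] at this
  refine this.trans ?_
  rw [div_mul_eq_mul_div]
  gcongr
  linarith

lemma Phi_deriv (p : ℝ[X]) (t : ℝ) (ht : 0 < t) :
    HasDerivAt (Phi p) ((∑' k : ℕ, (2 * (k:ℝ) + 1) * Fp (Dp p) ((2 * (k:ℝ) + 1) * t))) t := by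
  obtain ⟨C, hC, h⟩ := Fp_bound (Dp p) 3
  have hs : Summable (fun k : ℕ => 1 / ((k:ℝ)+1)^2) := by
    have := (summable_nat_add_iff 1).2 (Real.summable_one_div_nat_pow.2 (by omega : 1 < 2))
    simpa using this
  have hs2 := hs.mul_left (C / (t/2)^3)
  have htm : t ∈ Ioi (t/2) := by
    show t/2 < t
    linarith
  refine hasDerivAt_tsum_of_isPreconnected (t := Ioi (t/2)) (y₀ := t)
    (g := fun k : ℕ => fun z => Fp p ((2 * (k:ℝ) + 1) * z))
    (g' := fun k : ℕ => fun z => (2 * (k:ℝ) + 1) * Fp (Dp p) ((2 * (k:ℝ) + 1) * z))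
    hs2 isOpen_Ioi isPreconnected_Ioi ?_ ?_ htm (Fp_summable p ht) htm
  · intro k y hy
    have h1 : HasDerivAt (fun z : ℝ => (2 * (k:ℝ) + 1) * z) (2 * (k:ℝ) + 1) y :=
      ((hasDerivAt_id y).const_mul (2 * (k:ℝ) + 1)).congr_deriv (mul_one _)
    have := HasDerivAt.comp y (hasDerivAt_Fp p ((2 * (k:ℝ) + 1) * y)) h1
    exact this.congr_deriv (mul_comm _ _)
  · intro k y hy
    have hy' : t/2 < y := hy
    have hy0 : 0 < y := by linarith
    rw [norm_mul, Real.norm_eq_abs, Real.norm_eq_abs, abs_of_pos (by positivity)]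
    have hk : (0:ℝ) ≤ k := by positivity
    calc (2 * (k:ℝ) + 1) * |Fp (Dp p) ((2 * (k:ℝ) + 1) * y)|
        ≤ (2 * (k:ℝ) + 1) * (C / ((2 * (k:ℝ) + 1) * y)^3) := by
          gcongr; exact h _ (by positivity)
      _ = C / (y^3) * (1 / (2 * (k:ℝ) + 1)^2) := by field_simp
      _ ≤ _ := by gcongr; linarith

lemma Phi_Lp (s : ℝ) (p : ℝ[X]) (t : ℝ) (ht : 0 < t) :
    Phi (Lp s p) t = s * Phi p t +
      t * ∑' k : ℕ, (2 * (k:ℝ) + 1) * Fp (Dp p) ((2 * (k:ℝ) + 1) * t) := by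
  have h1 := Fp_summable p ht
  have h2 : Summable fun k : ℕ => t * ((2 * (k:ℝ) + 1) * Fp (Dp p) ((2 * (k:ℝ) + 1) * t)) := by
    have := (Fp_summable (X * Dp p) ht)
    refine this.congr fun k => ?_
    simp [Fp]; ring
  rw [← tsum_mul_left, Phi, Phi, ← tsum_mul_left, ← (h1.mul_left s).tsum_add h2]
  refine tsum_congr fun k => ?_
  rw [Fp_Lp]; ring

lemma cP_Lp (s : ℝ) (p : ℝ[X]) : cP (Lp s p) = (s - 1) * cP p := by
  have h1 := Fp_integrableOn p
  have h2 := Fp_integrableOn (X * Dp p)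
  have hd : ∀ x ∈ Ici (0:ℝ), HasDerivAt (Fp (X * p)) (Fp p x + Fp (X * Dp p) x) x := by
    intro x _
    refine (hasDerivAt_Fp (X * p) x).congr_deriv ?_
    simp [Fp, Dp]; ring
  have := integral_Ioi_of_hasDerivAt_of_tendsto' hd (h1.add h2) ((Fp_derivSeq (X * p)).tendsto 0)
  have h0 : Fp (X * p) 0 = 0 := by simp [Fp]
  rw [h0, integral_add h1 h2] at this
  have e : ∫ x in Ioi (0:ℝ), Fp (Lp s p) x = s * (∫ x in Ioi (0:ℝ), Fp p x)
      + ∫ x in Ioi (0:ℝ), Fp (X * Dp p) x := by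
    rw [← integral_const_mul, ← integral_add (h1.const_mul s) h2]
    congr 1
    ext x
    simp [Fp, Lp]; ring
  rw [cP, cP, e]
  linear_combination (1/2) * this

end UpsEM

namespace UpsEM

open Set Filter Topology MeasureTheory

open Polynomial

noncomputable def Ps (q : ℕ) (p : ℝ[X]) : ℕ → ℝ[X]
  | 0 => p
  | k+1 => Lp ((q:ℝ) + 1 - k) (Ps q p k)

lemma Ps_even (q : ℕ) (p : ℝ[X]) (hp : p.comp (-X) = p) (k : ℕ) :
    (Ps q p k).comp (-X) = Ps q p k := by
  induction k with
  | zero => exact hp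
  | succ k ih => exact Lp_comp _ _ ih

lemma cP_Ps (q : ℕ) (p : ℝ[X]) (k : ℕ) : cP (Ps q p k) = cP p * (q.descFactorial k : ℝ) := by
  induction k with
  | zero => simp [Ps]
  | succ k ih =>
    rw [Ps, cP_Lp, ih, Nat.descFactorial_succ]
    rcases le_or_gt k q with h | h
    · push_cast [Nat.cast_sub h]; ring
    · simp [Nat.descFactorial_eq_zero_iff_lt.2 h]

/-- comparison polynomial -/
noncomputable def Pk (q : ℕ) (c : ℝ) (k : ℕ) (x : ℝ) : ℝ := c * (q.descFactorial k : ℝ) * x^(q-k)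

lemma Pk_deriv (q : ℕ) (c : ℝ) (k : ℕ) (x : ℝ) : HasDerivAt (Pk q c k) (Pk q c (k+1) x) x := by
  have := (hasDerivAt_pow (q-k) x).const_mul (c * (q.descFactorial k : ℝ))
  refine this.congr_deriv ?_
  rw [Pk, Nat.descFactorial_succ, Nat.sub_sub]
  push_cast
  ring

noncomputable def Gs (q : ℕ) (p : ℝ[X]) (k : ℕ) (x : ℝ) : ℝ :=
  if 0 < x then x^((q:ℤ)+1-k) * Phi (Ps q p k) x else Pk q (cP p) k x

lemma Gs_flat (q : ℕ) (p : ℝ[X]) (hp : p.comp (-X) = p) (k M : ℕ) :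
    ∃ C : ℝ, 0 < C ∧ ∀ x : ℝ, 0 < x → |Gs q p k x - Pk q (cP p) k x| ≤ C * x^M * x^(q+1) := by
  obtain ⟨C, hC, h⟩ := Phi_flat (Ps q p k) (Ps_even q p hp k) (M+k)
  refine ⟨C, hC, fun x hx => ?_⟩
  rw [Gs, if_pos hx]
  have e : Pk q (cP p) k x = x^((q:ℤ)+1-k) * (cP (Ps q p k) / x) := by
    rw [cP_Ps, Pk]
    rcases le_or_gt k q with hk | hk
    · obtain ⟨d, rfl⟩ := Nat.exists_eq_add_of_le hk
      rw [show ((k+d:ℕ):ℤ) + 1 - k = ((d+1:ℕ):ℤ) by push_cast; ring, zpow_natCast,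
        Nat.add_sub_cancel_left]
      field_simp
      ring
    · simp [Nat.descFactorial_eq_zero_iff_lt.2 hk]
  rw [e, ← mul_sub, abs_mul, abs_of_pos (by positivity)]
  calc x^((q:ℤ)+1-k) * |Phi (Ps q p k) x - cP (Ps q p k) / x|
      ≤ x^((q:ℤ)+1-k) * (C * x^(M+k)) := by gcongr; exact h x hx
    _ = C * x^M * (x^((q:ℤ)+1-k) * x^k) := by rw [pow_add]; ring
    _ = _ := by
      congr 1
      rw [← zpow_natCast x k, ← zpow_add₀ hx.ne', ← zpow_natCast x (q+1)]
      congr 1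
      push_cast; ring

lemma Gs_derivSeq (q : ℕ) (p : ℝ[X]) (hp : p.comp (-X) = p) : DerivSeq (Gs q p) := by
  constructor
  · intro k x
    rcases lt_trichotomy x 0 with hx | rfl | hx
    · have e : Gs q p (k+1) x = Pk q (cP p) (k+1) x := by rw [Gs, if_neg (by linarith)]
      rw [e]
      refine (Pk_deriv q (cP p) k x).congr_of_eventuallyEq ?_
      filter_upwards [eventually_lt_nhds hx] with y hy
      rw [Gs, if_neg (by linarith)]
    · have e : Gs q p (k+1) 0 = Pk q (cP p) (k+1) 0 := by rw [Gs, if_neg (by linarith)]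
      rw [e]
      have hd : HasDerivAt (fun x => Gs q p k x - Pk q (cP p) k x) 0 0 := by
        obtain ⟨C, hC, h⟩ := Gs_flat q p hp k 2
        have hO : (fun x => Gs q p k x - Pk q (cP p) k x) =O[𝓝 0] fun x : ℝ => (x - 0)^2 := by
          refine Asymptotics.IsBigO.of_bound C ?_
          filter_upwards [eventually_lt_nhds (zero_lt_one' ℝ)] with y hy
          rcases le_or_gt y 0 with h0 | h0
          · rw [Gs, if_neg (by linarith)]
            simp; positivity
          · refine (h y h0).trans ?_
            have : y^(q+1) ≤ 1 := pow_le_one₀ h0.le hy.le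
            simp
            nlinarith [mul_pos hC (pow_pos h0 2)]
        have h0 : Gs q p k 0 - Pk q (cP p) k 0 = 0 := by rw [Gs, if_neg (by linarith)]; ring
        rw [hasDerivAt_iff_isLittleO]
        simp only [h0, smul_zero, sub_zero]
        refine hO.trans_isLittleO ?_
        simpa using Asymptotics.isLittleO_pow_id (𝕜 := ℝ) (one_lt_two)
      have := hd.add (Pk_deriv q (cP p) k 0)
      rw [zero_add] at this
      refine this.congr_of_eventuallyEq (Eventually.of_forall fun y => ?_)
      simp
    · have h1 := (hasDerivAt_zpow ((q:ℤ)+1-k) x (Or.inl hx.ne')).mul (Phi_deriv (Ps q p k) x hx)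
      have e : Gs q p (k+1) x = x^((q:ℤ)+1-(k+1:ℕ)) * Phi (Ps q p (k+1)) x := by
        rw [Gs, if_pos hx]
      rw [e]
      refine (h1.congr_deriv ?_).congr_of_eventuallyEq ?_
      · rw [Ps, Phi_Lp _ _ _ hx]
        have e1 : x^((q:ℤ)+1-k) = x^((q:ℤ)+1-(k+1:ℕ)) * x := by
          rw [← zpow_add_one₀ hx.ne']; congr 1; push_cast; ring
        have e2 : (q:ℤ)+1-k-1 = (q:ℤ)+1-(k+1:ℕ) := by push_cast; ring
        rw [e1, e2]
        push_cast
        ring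
      · filter_upwards [eventually_gt_nhds hx] with y hy
        rw [Gs, if_pos hy]; rfl
  · intro k
    obtain ⟨C, hC, h⟩ := Phi_decay (Ps q p k) (q+3) (by omega)
    refine ⟨C, fun x hx => ?_⟩
    have hx0 : 0 < x := by linarith
    rw [Gs, if_pos hx0, abs_mul, abs_of_pos (by positivity)]
    calc x^((q:ℤ)+1-k) * |Phi (Ps q p k) x| ≤ x^((q:ℤ)+1) * (C / x^(q+3)) := by
          have hz : x^((q:ℤ)+1-k) ≤ x^((q:ℤ)+1) := zpow_le_zpow_right₀ hx (by omega)
          exact mul_le_mul hz (h x hx0) (abs_nonneg _) (by positivity)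
      _ = C / x^2 := by
          rw [show ((q:ℤ)+1) = ((q+1:ℕ):ℤ) by push_cast; ring, zpow_natCast]
          field_simp
          ring

/-- main expansion -/
lemma A_expand (q : ℕ) (p : ℝ[X]) (hp : p.comp (-X) = p) (M : ℕ) :
    ∃ C : ℝ, 0 < C ∧ ∀ t : ℝ, 0 < t →
      |(∑' a : ℕ, (((a:ℝ)+1)*t)^(q+1) * Phi p (((a:ℝ)+1) * t)) -
        (t⁻¹ * (∫ x in Ioi (0:ℝ), x^(q+1) * Phi p x) +
          cP p * (riemannZeta (1 - ((q+1:ℕ):ℂ))).re * t^q)| ≤ C * t^(M+q) := by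
  obtain ⟨C, hC, h⟩ := euler_mac (Gs_derivSeq q p hp) (M+q)
  refine ⟨C, hC, fun t ht => ?_⟩
  have h := h t ht
  have e0 : ∀ x : ℝ, 0 < x → Gs q p 0 x = x^(q+1) * Phi p x := by
    intro x hx
    rw [Gs, if_pos hx, Ps]
    rw [show (q:ℤ)+1-((0:ℕ):ℤ) = ((q+1:ℕ):ℤ) by push_cast; ring, zpow_natCast]
  have e1 : ∑' a : ℕ, Gs q p 0 (((a:ℝ)+1) * t) =
      ∑' a : ℕ, (((a:ℝ)+1)*t)^(q+1) * Phi p (((a:ℝ)+1) * t) :=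
    tsum_congr fun a => e0 _ (by positivity)
  have e2 : ∫ x in Ioi (0:ℝ), Gs q p 0 x = ∫ x in Ioi (0:ℝ), x^(q+1) * Phi p x :=
    setIntegral_congr_fun measurableSet_Ioi fun x hx => e0 x hx
  have hz : (riemannZeta (1 - ((q+1:ℕ):ℂ))).re =
      (-1)^q * (_root_.bernoulli (q+1) : ℝ) / (q+1) := by
    have : (1 - ((q+1:ℕ):ℂ)) = -(q:ℂ) := by push_cast; ring
    rw [this, riemannZeta_neg_nat_eq_bernoulli]
    have : ((-1)^q * (_root_.bernoulli (q+1) : ℂ) / ((q:ℂ)+1)) =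
      (((-1)^q * (_root_.bernoulli (q+1) : ℝ) / (q+1) : ℝ) : ℂ) := by push_cast; rfl
    rw [this, Complex.ofReal_re]
  have e3 : ∑ k ∈ Finset.range (M+q+1), (-1:ℝ)^k * (_root_.bernoulli (k+1) : ℝ) /
      ((k+1).factorial : ℝ) * (t^k * Gs q p k 0) =
      cP p * (riemannZeta (1 - ((q+1:ℕ):ℂ))).re * t^q := by
    rw [Finset.sum_eq_single q]
    · rw [Gs, if_neg (lt_irrefl _), Pk, hz, Nat.descFactorial_self, Nat.factorial_succ]
      have : (q.factorial : ℝ) ≠ 0 := by positivity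
      have : (q : ℝ) + 1 ≠ 0 := by positivity
      simp
      field_simp
      try ring
    · intro k _ hk
      rw [Gs, if_neg (lt_irrefl _), Pk]
      rcases lt_or_gt_of_ne hk with h | h
      · rw [zero_pow (by omega)]; simp
      · simp [Nat.descFactorial_eq_zero_iff_lt.2 h]
    · intro h; simp at h
  rw [e1, e2, e3] at h
  exact h

end UpsEM

namespace UpsEM

open Set Filter Topology MeasureTheory

open Polynomial

noncomputable def p0 (j : ℕ) : ℝ[X] := (2 * X^2 - 1) * X^(2*j)

lemma p0_even (j : ℕ) : (p0 j).comp (-X) = p0 j := by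
  simp [p0]

lemma Fp_p0 (j : ℕ) (x : ℝ) : Fp (p0 j) x = (2 * x^2 - 1) * x^(2*j) * Real.exp (-x^2) := by
  simp [Fp, p0]

lemma gauss_moment (n : ℕ) : ∫ x in Ioi (0:ℝ), Fp (X^n) x = 1/2 * Real.Gamma (((n:ℝ)+1)/2) := by
  have h := integral_rpow_mul_exp_neg_rpow (p := 2) (q := n) (by norm_num)
    (by have : (0:ℝ) ≤ n := by positivity
        linarith)
  rw [← h]
  refine setIntegral_congr_fun measurableSet_Ioi fun x hx => ?_
  simp [Fp]

lemma p0_moment (j r : ℕ) : ∫ x in Ioi (0:ℝ), x^r * Fp (p0 j) x =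
    ((j:ℝ) + r/2) * Real.Gamma ((j:ℝ) + ((r:ℝ)+1)/2) := by
  have e : ∀ x : ℝ, x^r * Fp (p0 j) x = 2 * Fp (X^(2*j+r+2)) x - Fp (X^(2*j+r)) x := by
    intro x
    simp [Fp, p0]; ring
  simp only [e]
  rw [integral_sub ((Fp_integrableOn _).const_mul 2) (Fp_integrableOn _), integral_const_mul,
    gauss_moment, gauss_moment]
  have h : (((2*j+r+2:ℕ):ℝ)+1)/2 = ((j:ℝ) + ((r:ℝ)+1)/2) + 1 := by push_cast; ring
  have h' : (((2*j+r:ℕ):ℝ)+1)/2 = ((j:ℝ) + ((r:ℝ)+1)/2) := by push_cast; ring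
  rw [h, h', Real.Gamma_add_one (by positivity)]
  ring

lemma odd_sum (n : ℕ) (hn : 1 < n) : ∑' k : ℕ, 1 / (2*(k:ℝ)+1)^n * 2^n =
    (2^n - 1) * ∑' k : ℕ, 1 / ((k:ℝ)+1)^n := by
  have h : Summable (fun k : ℕ => 1 / ((k:ℝ)+1)^n) := by
    have := (summable_nat_add_iff 1).2 (Real.summable_one_div_nat_pow.2 hn)
    simpa using this
  set f : ℕ → ℝ := fun k : ℕ => 1 / ((k:ℝ)+1)^n with hf
  have h1 : Summable fun k : ℕ => f (2 * k) := h.comp_injective (fun a b h => by simpa using h)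
  have h2 : Summable fun k : ℕ => f (2 * k + 1) := h.comp_injective (fun a b h => by simpa using h)
  have h3 := tsum_even_add_odd h1 h2
  have e1 : ∀ k : ℕ, f (2*k+1) = (1/2^n) * f k := by
    intro k
    simp only [hf]
    push_cast
    rw [show 2*(k:ℝ)+1+1 = 2 * (k+1) by ring, mul_pow]
    field_simp
  have e2 : ∀ k : ℕ, f (2*k) = 1 / (2*(k:ℝ)+1)^n := by
    intro k; simp [hf]
  simp only [e1, e2, tsum_mul_left] at h3
  rw [tsum_mul_right]
  have : (2:ℝ)^n ≠ 0 := by positivity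
  field_simp at h3 ⊢
  linear_combination h3

lemma Phi_moment (p : ℝ[X]) (r : ℕ) (hr : 1 ≤ r) : ∫ x in Ioi (0:ℝ), x^r * Phi p x =
    (∑' k : ℕ, 1 / (2*(k:ℝ)+1)^(r+1)) * ∫ x in Ioi (0:ℝ), x^r * Fp p x := by
  have hI : IntegrableOn (fun x : ℝ => x^r * Fp p x) (Ioi 0) := by
    refine (Fp_integrableOn (X^r * p)).congr_fun (fun x _ => ?_) measurableSet_Ioi
    simp [Fp]; ring
  set F : ℕ → ℝ → ℝ := fun k x => x^r * Fp p ((2*(k:ℝ)+1) * x) with hF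
  have hb : ∀ k : ℕ, (0:ℝ) < 2*(k:ℝ)+1 := fun k => by positivity
  have eF : ∀ k : ℕ, F k = fun x => (1 / (2*(k:ℝ)+1)^r) *
      ((fun y : ℝ => y^r * Fp p y) ((2*(k:ℝ)+1) * x)) := by
    intro k
    ext x
    have := (hb k).ne'
    simp only [hF, mul_pow]
    field_simp
  have hFi : ∀ k, IntegrableOn (F k) (Ioi 0) := by
    intro k
    rw [eF k]
    refine Integrable.const_mul ?_ _
    exact (integrableOn_Ioi_comp_mul_left_iff (fun y : ℝ => y^r * Fp p y) 0 (hb k)).2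
      (by simpa using hI)
  have hFint : ∀ k : ℕ, ∫ x in Ioi (0:ℝ), F k x =
      1 / (2*(k:ℝ)+1)^(r+1) * ∫ x in Ioi (0:ℝ), x^r * Fp p x := by
    intro k
    rw [eF k, integral_const_mul,
      integral_comp_mul_left_Ioi (fun y : ℝ => y^r * Fp p y) 0 (hb k)]
    have := (hb k).ne'
    simp
    field_simp
    ring
  have hFn : ∀ k : ℕ, ∫ x in Ioi (0:ℝ), ‖F k x‖ =
      1 / (2*(k:ℝ)+1)^(r+1) * ∫ x in Ioi (0:ℝ), |x^r * Fp p x| := by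
    intro k
    have : ∀ x, ‖F k x‖ = (1 / (2*(k:ℝ)+1)^r) *
      ((fun y : ℝ => |y^r * Fp p y|) ((2*(k:ℝ)+1) * x)) := by
      intro x
      rw [eF k, norm_mul, Real.norm_eq_abs, Real.norm_eq_abs, abs_of_pos]
      have := hb k
      positivity
    simp only [this]
    rw [integral_const_mul,
      integral_comp_mul_left_Ioi (fun y : ℝ => |y^r * Fp p y|) 0 (hb k)]
    have := (hb k).ne'
    simp
    field_simp
    ring
  have hs : Summable (fun k : ℕ => 1 / (2*(k:ℝ)+1)^(r+1)) := by
    have h := (summable_nat_add_iff 1).2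
      (Real.summable_one_div_nat_pow.2 (by omega : 1 < r+1))
    have := h.comp_injective (i := fun k : ℕ => 2 * k) (fun a b h => by simpa using h)
    simpa [Function.comp_def] using this
  have key := hasSum_integral_of_summable_integral_norm (μ := volume.restrict (Ioi (0:ℝ)))
    (F := F) hFi (by simp only [hFn]; exact hs.mul_right _)
  have e := key.tsum_eq
  simp only [hFint, tsum_mul_right] at e
  rw [e]
  refine setIntegral_congr_fun measurableSet_Ioi fun x _ => ?_
  simp only [hF, Phi, tsum_mul_left]

lemma parity_sum (B : ℕ → ℝ) (hB : Summable B) (N : ℕ) :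
    ∑' h : ℕ, (if h % 2 = N % 2 then B (h+1) else 0) =
      if N % 2 = 0 then ∑' i, B (2*i+1) else (∑' i, B i) - (∑' i, B (2*i+1)) - B 0 := by
  have h1 : Summable fun k : ℕ => B (2 * k) := hB.comp_injective (fun a b h => by simpa using h)
  have h2 : Summable fun k : ℕ => B (2 * k + 1) := hB.comp_injective (fun a b h => by simpa using h)
  have h3 := tsum_even_add_odd h1 h2
  have h4 := h1.tsum_eq_zero_add
  have h5 : Summable fun k : ℕ => B (2 * (k+1)) :=
    hB.comp_injective (fun a b h => by simpa using h)
  set v : ℕ → ℝ := fun h => if h % 2 = N % 2 then B (h+1) else 0 with hv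
  rcases Nat.mod_two_eq_zero_or_one N with hN | hN
  · have e1 : ∀ i, v (2*i) = B (2*i+1) := fun i => by simp [hv, hN]
    have e2 : ∀ i, v (2*i+1) = 0 := fun i => by
      simp only [hv, hN]; rw [if_neg (by omega)]
    rw [if_pos hN, ← tsum_even_add_odd (f := v) (by simpa only [e1] using h2)
      (by simp only [e2]; exact summable_zero)]
    simp [e1, e2]
  · have e1 : ∀ i, v (2*i) = 0 := fun i => by
      simp only [hv, hN]; rw [if_neg (by omega)]
    have e2 : ∀ i, v (2*i+1) = B (2*(i+1)) := fun i => by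
      simp only [hv, hN]; rw [if_pos (by omega)]; rfl
    rw [if_neg (by omega), ← tsum_even_add_odd (f := v) (by simp only [e1]; exact summable_zero)
      (by simpa only [e2] using h5)]
    simp only [e1, e2, tsum_zero]
    simp only [mul_zero] at h4
    linarith

lemma outer (q : ℕ) (p : ℝ[X]) (hp : p.comp (-X) = p) (M : ℕ) :
    ∃ C : ℝ, 0 < C ∧ ∀ (N : ℕ) (t : ℝ), 0 < t →
      |(∑' h : ℕ, (if h % 2 = N % 2 then (((h:ℝ)+2)*t)^(q+1) * Phi p (((h:ℝ)+2)*t) else 0)) -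
        ((2*t)⁻¹ * (∫ x in Ioi (0:ℝ), x^(q+1) * Phi p x) + cP p * kappaVal N (q+1) * t^q)|
        ≤ C * t^(M+1+q) := by
  obtain ⟨C1, hC1, h1⟩ := A_expand q p hp (M+1)
  obtain ⟨C2, hC2, h2⟩ := Gs_flat q p hp 0 M
  refine ⟨C1 + C1 * 2^(M+1+q) + C2, by positivity, fun N t ht => ?_⟩
  have a1 := h1 t ht
  have a2 := h1 (2*t) (by positivity)
  have a3 := h2 t ht
  have eG : ∀ x : ℝ, 0 < x → Gs q p 0 x = x^(q+1) * Phi p x := by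
    intro x hx
    rw [Gs, if_pos hx, Ps]
    rw [show (q:ℤ)+1-((0:ℕ):ℤ) = ((q+1:ℕ):ℤ) by push_cast; ring, zpow_natCast]
  rw [eG t ht, Pk] at a3
  simp only [Nat.descFactorial_zero, Nat.cast_one, mul_one, Nat.sub_zero] at a3
  set B : ℕ → ℝ := fun a => (((a:ℝ)+1)*t)^(q+1) * Phi p (((a:ℝ)+1) * t) with hB
  have hBs : Summable B := by
    refine ((Gs_derivSeq q p hp).summable 0 ht).congr fun a => ?_
    rw [eG _ (by positivity)]
  have e1 : ∀ h : ℕ, (if h % 2 = N % 2 then (((h:ℝ)+2)*t)^(q+1) * Phi p (((h:ℝ)+2)*t) else 0) =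
      if h % 2 = N % 2 then B (h+1) else 0 := by
    intro h
    simp only [hB]
    push_cast
    rw [show (h:ℝ)+1+1 = h+2 by ring]
  have e2 : ∑' a : ℕ, (((a:ℝ)+1)*(2*t))^(q+1) * Phi p (((a:ℝ)+1) * (2*t)) = ∑' i, B (2*i+1) := by
    refine tsum_congr fun a => ?_
    simp only [hB]
    push_cast
    rw [show (2*(a:ℝ)+1+1)*t = (a+1)*(2*t) by ring]
  have e3 : B 0 = t^(q+1) * Phi p t := by simp [hB]
  simp only [e1]
  rw [parity_sum B hBs N]
  rw [e2] at a2
  rw [← e3] at a3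
  have hk : kappaVal N (q+1) = if N % 2 = 0 then 2^q * (riemannZeta (1 - ((q+1:ℕ):ℂ))).re else
      (1 - 2^q) * (riemannZeta (1 - ((q+1:ℕ):ℂ))).re - 1 := by
    have : (2:ℝ)^(((q+1:ℕ):ℝ)-1) = 2^q := by
      rw [← Real.rpow_natCast]; congr 1; push_cast; ring
    rw [kappaVal, this]
  rw [hk]
  set Z := (riemannZeta (1 - ((q+1:ℕ):ℂ))).re
  set I := ∫ x in Ioi (0:ℝ), x^(q+1) * Phi p x
  have hpow : 0 < t^(M+1+q) := by positivity
  have hp2 : (2*t)^(M+1+q) = 2^(M+1+q) * t^(M+1+q) := mul_pow _ _ _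
  have hp3 : C2 * t^M * t^(q+1) = C2 * t^(M+1+q) := by ring
  rw [hp2] at a2
  rw [hp3] at a3
  have hp4 : (2*t)^q = 2^q * t^q := mul_pow _ _ _
  rw [hp4] at a2
  have hti : t⁻¹ = 2 * (2*t)⁻¹ := by field_simp
  rw [hti] at a1
  rw [abs_le] at a1 a2 a3
  have p1 : 0 < C1 * t^(M+1+q) := by positivity
  have p2 : 0 < C1 * (2^(M+1+q) * t^(M+1+q)) := by positivity
  have p3 : 0 < C2 * t^(M+1+q) := by positivity
  split_ifs with hN
  · rw [abs_le]
    constructor <;> linarith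
  · rw [abs_le]
    constructor <;> linarith

end UpsEM

namespace UpsEM

open Set Filter Topology MeasureTheory

lemma summand_eq (j r N : ℕ) (s t : ℝ) (hs : 0 < s) (hm : (N:ℝ)/2 = s^2) (ht : t = 1/(2*s))
    (h k : ℕ) : upsSummandJR j r N (h, k) =
      if h % 2 = N % 2 then ((s^2)^j / t^r) *
        ((((h:ℝ)+2)*t)^r * Fp (p0 j) ((2*(k:ℝ)+1) * (((h:ℝ)+2)*t))) else 0 := by
  rw [upsSummandJR]
  split_ifs
  · rw [Fp_p0]
    simp only
    set x := (2*(k:ℝ)+1) * (((h:ℝ)+2)*t) with hx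
    have ht0 : 0 < t := by rw [ht]; positivity
    have hu : upsHK h k = s * x := by
      rw [hx, ht, upsHK]; field_simp
    rw [hu, hm, mul_pow s x 2, mul_pow s x (2*j), mul_pow _ t r]
    have e1 : (2 * (s^2 * x^2) - s^2) / s^2 = 2 * x^2 - 1 := by field_simp
    have e2 : s^2 * x^2 / s^2 = x^2 := by field_simp
    rw [e1, e2, pow_mul s 2 j]
    field_simp
  · rfl

lemma summand_summable (j r N : ℕ) (s t : ℝ) (hs : 0 < s) (hm : (N:ℝ)/2 = s^2)
    (ht : t = 1/(2*s)) : Summable (fun p : ℕ × ℕ => |upsSummandJR j r N p|) := by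
  have ht0 : 0 < t := by rw [ht]; positivity
  obtain ⟨C, hC, hF⟩ := Fp_bound (p0 j) (r+2)
  have h1 : Summable (fun k : ℕ => 1 / ((k:ℝ)+1)^2) := by
    have := (summable_nat_add_iff 1).2 (Real.summable_one_div_nat_pow.2 (by omega : 1 < 2))
    simpa using this
  have h2 : Summable (fun p : ℕ × ℕ => 1 / ((p.1:ℝ)+1)^2 * (1 / ((p.2:ℝ)+1)^2)) :=
    h1.mul_of_nonneg h1 (fun k => by positivity) (fun k => by positivity)
  refine Summable.of_nonneg_of_le (fun p => abs_nonneg _) ?_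
    (h2.mul_left (((s^2)^j / t^r) * (C / t^2)))
  rintro ⟨h, k⟩
  rw [summand_eq j r N s t hs hm ht h k]
  split_ifs
  · have hh : (0:ℝ) ≤ h := by positivity
    have hk : (0:ℝ) ≤ k := by positivity
    rw [abs_mul, abs_of_pos (by positivity : 0 < (s^2)^j / t^r), abs_mul,
      abs_of_pos (by positivity : 0 < (((h:ℝ)+2)*t)^r), mul_assoc]
    refine mul_le_mul_of_nonneg_left ?_ (by positivity)
    calc (((h:ℝ)+2)*t)^r * |Fp (p0 j) ((2*(k:ℝ)+1) * (((h:ℝ)+2)*t))|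
        ≤ (((h:ℝ)+2)*t)^r * (C / ((2*(k:ℝ)+1) * (((h:ℝ)+2)*t))^(r+2)) := by
          gcongr; exact hF _ (by positivity)
      _ = C / t^2 * (1 / ((h:ℝ)+2)^2 * (1 / (2*(k:ℝ)+1)^(r+2))) := by
          simp only [mul_pow, pow_add _ r 2]
          field_simp
      _ ≤ C / t^2 * (1 / ((h:ℝ)+1)^2 * (1 / ((k:ℝ)+1)^2)) := by
          have : ((k:ℝ)+1)^2 ≤ (2*(k:ℝ)+1)^(r+2) := by
            calc ((k:ℝ)+1)^2 ≤ (2*(k:ℝ)+1)^2 := by gcongr; linarith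
              _ ≤ (2*(k:ℝ)+1)^(r+2) := pow_le_pow_right₀ (by linarith) (by omega)
          gcongr
          linarith
  · simp; positivity

lemma summand_tsum (j r N : ℕ) (s t : ℝ) (hs : 0 < s) (hm : (N:ℝ)/2 = s^2)
    (ht : t = 1/(2*s)) : ∑' p : ℕ × ℕ, upsSummandJR j r N p = ((s^2)^j / t^r) *
      ∑' h : ℕ, (if h % 2 = N % 2 then (((h:ℝ)+2)*t)^r * Phi (p0 j) (((h:ℝ)+2)*t) else 0) := by
  have hsum := (summand_summable j r N s t hs hm ht).of_abs
  rw [hsum.tsum_prod, ← tsum_mul_left]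
  refine tsum_congr fun h => ?_
  simp only [summand_eq j r N s t hs hm ht h]
  split_ifs
  · rw [tsum_mul_left, tsum_mul_left, Phi]
  · simp

end UpsEM

/-- With `m = N/2` and fixed `j ≥ 0`, `r ≥ 1`,
`Σ_{h,k≥0, h ≡ N (2)} ((2υ_{h,k}² − m)/m) υ_{h,k}^{2j} (h+2)^r exp(−υ_{h,k}²/m)
  = j Γ(j+1/2) κ_N(1−r) m^{j+1/2}
    + (1/2)(j+r/2) Γ(j+(r+1)/2) (2^{r+1}−1) ζ(r+1) m^{j+(r+1)/2} + O(m^{−K})`,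
the sum converging absolutely. -/
theorem ups_harmonic_sum_asymptotics_jr (j r : ℕ) (hr : 1 ≤ r) (K : ℝ) (hK : 0 < K) :
    ∃ C > (0 : ℝ), ∃ N₀ : ℕ, ∀ N : ℕ, N₀ ≤ N →
      Summable (fun p : ℕ × ℕ => |upsSummandJR j r N p|) ∧
      |(∑' p : ℕ × ℕ, upsSummandJR j r N p) -
          ((j : ℝ) * Real.Gamma ((j : ℝ) + 1 / 2) * kappaVal N r *
              ((N : ℝ) / 2) ^ ((j : ℝ) + 1 / 2) +
            1 / 2 * ((j : ℝ) + (r : ℝ) / 2) * Real.Gamma ((j : ℝ) + ((r : ℝ) + 1) / 2) *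
              (2 ^ (r + 1) - 1) * (∑' k : ℕ, 1 / ((k : ℝ) + 1) ^ (r + 1)) *
              ((N : ℝ) / 2) ^ ((j : ℝ) + ((r : ℝ) + 1) / 2))| ≤
        C * ((N : ℝ) / 2) ^ (-K) := by
  obtain ⟨q, rfl⟩ : ∃ q, r = q + 1 := ⟨r - 1, by omega⟩
  set L := ⌈K⌉₊ with hL
  have hKL : K ≤ L := Nat.le_ceil K
  obtain ⟨C, hC, h⟩ := UpsEM.outer q (UpsEM.p0 j) (UpsEM.p0_even j) (2 * (j + L))
  refine ⟨C, hC, 2, fun N hN => ?_⟩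
  have hN2 : (2:ℝ) ≤ N := by exact_mod_cast hN
  set m : ℝ := (N:ℝ)/2 with hmdef
  have hm1 : 1 ≤ m := by rw [hmdef]; linarith
  have hm0 : 0 < m := by linarith
  obtain ⟨s, hsdef⟩ : ∃ s, s = Real.sqrt m := ⟨_, rfl⟩
  have hs0 : 0 < s := by rw [hsdef]; exact Real.sqrt_pos.2 hm0
  have hms : m = s^2 := by rw [hsdef, Real.sq_sqrt hm0.le]
  obtain ⟨t, ht⟩ : ∃ t : ℝ, t = 1/(2*s) := ⟨_, rfl⟩
  have ht0 : 0 < t := by rw [ht]; positivity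
  refine ⟨UpsEM.summand_summable j (q+1) N s t hs0 hms ht, ?_⟩
  rw [UpsEM.summand_tsum j (q+1) N s t hs0 hms ht]
  have hb := h N t ht0
  have hI := UpsEM.Phi_moment (UpsEM.p0 j) (q+1) (by omega)
  rw [UpsEM.p0_moment] at hI
  have hodd := UpsEM.odd_sum (q+1+1) (by omega)
  rw [tsum_mul_right] at hodd
  have hc : UpsEM.cP (UpsEM.p0 j) = 1/2 * (j * Real.Gamma ((j:ℝ) + 1/2)) := by
    have := UpsEM.p0_moment j 0
    rw [UpsEM.cP]
    simp only [pow_zero, one_mul] at this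
    rw [this]
    simp
  have hr1 : m ^ ((j:ℝ) + 1/2) = (s^2)^j * s := by
    rw [Real.rpow_add hm0, Real.rpow_natCast, ← Real.sqrt_eq_rpow, ← hsdef, ← hms]
  have hr2 : m ^ ((j:ℝ) + (((q+1:ℕ):ℝ) + 1)/2) = (s^2)^j * s^(q+1+1) := by
    rw [Real.rpow_add hm0, Real.rpow_natCast, ← hms]
    congr 1
    rw [hms, ← Real.rpow_natCast s 2, ← Real.rpow_mul hs0.le, ← Real.rpow_natCast s (q+1+1)]
    congr 1
    push_cast; ring
  rw [hr1, hr2]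
  set W := (s^2)^j / t^(q+1) with hW
  have hW0 : 0 < W := by positivity
  set S := ∑' h : ℕ, (if h % 2 = N % 2 then
    (((h:ℝ)+2)*t)^(q+1) * UpsEM.Phi (UpsEM.p0 j) (((h:ℝ)+2)*t) else 0) with hS
  set Zt := ∑' k : ℕ, 1 / ((k:ℝ)+1)^(q+1+1) with hZt
  set I := ∫ x in Set.Ioi (0:ℝ), x^(q+1) * UpsEM.Phi (UpsEM.p0 j) x with hIdef
  have hmain : (j : ℝ) * Real.Gamma ((j : ℝ) + 1 / 2) * kappaVal N (q+1) * ((s^2)^j * s) +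
      1 / 2 * ((j : ℝ) + ((q+1:ℕ) : ℝ) / 2) * Real.Gamma ((j : ℝ) + (((q+1:ℕ) : ℝ) + 1) / 2) *
      (2 ^ (q+1+1) - 1) * Zt * ((s^2)^j * s^(q+1+1)) =
      W * ((2*t)⁻¹ * I + UpsEM.cP (UpsEM.p0 j) * kappaVal N (q+1) * t^q) := by
    rw [hc, hI, hW]
    have e1 : (s^2)^j / t^(q+1) = (s^2)^j * (2^(q+1) * s^(q+1)) := by
      rw [ht, one_div, inv_pow, div_inv_eq_mul, mul_pow]
    have e2 : (2*t)⁻¹ = s := by rw [ht]; field_simp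
    have e3 : (2^(q+1) * s^(q+1)) * t^q = 2 * s := by
      rw [ht, ← mul_pow, pow_succ, one_div, inv_pow]
      field_simp
    rw [e2, e1]
    linear_combination (-(1/2) * ((s^2)^j * s^(q+1+1)) * (((j : ℝ) + ((q+1:ℕ) : ℝ) / 2) *
      Real.Gamma ((j : ℝ) + (((q+1:ℕ) : ℝ) + 1) / 2))) * hodd -
      ((s^2)^j * (1/2 * (j * Real.Gamma ((j:ℝ) + 1/2))) * kappaVal N (q+1)) * e3
  rw [hmain, ← mul_sub, abs_mul, abs_of_pos hW0]
  calc W * |S - ((2*t)⁻¹ * I + UpsEM.cP (UpsEM.p0 j) * kappaVal N (q+1) * t^q)|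
      ≤ W * (C * t^(2 * (j + L) + 1 + q)) := by gcongr
    _ = C * ((s^2)^j * t^(2*(j+L))) := by
        rw [hW, show 2 * (j + L) + 1 + q = 2 * (j+L) + (q+1) by ring, pow_add]
        field_simp
        ring
    _ ≤ C * ((s^2)^j * (1/s)^(2*(j+L))) := by
        gcongr
        rw [ht]
        gcongr
        linarith
    _ = C * m^(-(L:ℝ)) := by
        rw [Real.rpow_neg hm0.le, Real.rpow_natCast, hms, pow_mul, pow_add, one_div, inv_pow,
          inv_pow, inv_pow]
        field_simp
    _ ≤ C * m^(-K) := by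
        gcongr
end
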